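/- arXiv:1305.0729 — 11 statements merged into one kernel-verified Lean document; each statement's English description precedes it below -/
import Mathlib

section
/- Let n ≥ 2 and let F ∈ M_n(ℤ) be a symmetric matrix, with bilinear form (x,y) := xᵗFy. Suppose u, w ∈ ℤⁿ satisfy (u,u) = (w,w) = −2 and (u,w) = −3. Then: (1) (u−w, u−w) = 2 and (u−2w, u−2w) = 2; (2) r_u ∘ r_w = r_{u−w} ∘ r_{u−2w} as linear maps on ℚⁿ; (3) r_{u−w}(u) = w. -/
open Matrix

/-- Cast an integer vector to a rational vector. -/
def qv {n : ℕ} (u : Fin n → ℤ) : Fin n → ℚ := fun i => (u i : ℚ)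

/-- Cast an integer matrix to a rational matrix. -/
def qm {n : ℕ} (F : Matrix (Fin n) (Fin n) ℤ) : Matrix (Fin n) (Fin n) ℚ :=
  F.map (fun x => (x : ℚ))

/-- The reflection `r_v : y ↦ y - (2 (v,y)/(v,v)) v` in the root `v`, with respect to the
bilinear form `(x,y) = xᵗ F y`. -/
def reflVec {n : ℕ} (F : Matrix (Fin n) (Fin n) ℚ) (v : Fin n → ℚ) :
    (Fin n → ℚ) → (Fin n → ℚ) :=
  fun y => y - (2 * (v ⬝ᵥ F.mulVec y) / (v ⬝ᵥ F.mulVec v)) • v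

theorem aux_cast {n : ℕ} (F : Matrix (Fin n) (Fin n) ℤ) (u w : Fin n → ℤ) :
    qv u ⬝ᵥ (qm F).mulVec (qv w) = ((u ⬝ᵥ F.mulVec w : ℤ) : ℚ) := by
  simp [qv, qm, dotProduct, Matrix.mulVec]

theorem stmt0 (n : ℕ) (hn : 2 ≤ n) (F : Matrix (Fin n) (Fin n) ℤ) (hF : F.IsSymm)
    (u w : Fin n → ℤ)
    (huu : u ⬝ᵥ F.mulVec u = -2) (hww : w ⬝ᵥ F.mulVec w = -2)
    (huw : u ⬝ᵥ F.mulVec w = -3) :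
    ((u - w) ⬝ᵥ F.mulVec (u - w) = 2 ∧
      (u - (2 : ℤ) • w) ⬝ᵥ F.mulVec (u - (2 : ℤ) • w) = 2) ∧
    (reflVec (qm F) (qv u) ∘ reflVec (qm F) (qv w) =
      reflVec (qm F) (qv u - qv w) ∘ reflVec (qm F) (qv u - (2 : ℚ) • qv w)) ∧
    reflVec (qm F) (qv u - qv w) (qv u) = qv w := by
  have hwu : w ⬝ᵥ F.mulVec u = -3 := by
    rw [← huw, Matrix.dotProduct_mulVec, ← Matrix.mulVec_transpose, hF.eq, dotProduct_comm]
  have quu := aux_cast F u u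
  have qww := aux_cast F w w
  have quw := aux_cast F u w
  have qwu := aux_cast F w u
  rw [huu] at quu
  rw [hww] at qww
  rw [huw] at quw
  rw [hwu] at qwu
  push_cast at quu qww quw qwu
  refine ⟨⟨?_, ?_⟩, ?_, ?_⟩
  · simp only [Matrix.mulVec_sub, sub_dotProduct, dotProduct_sub, huu, hww, huw, hwu]
    norm_num
  · simp only [Matrix.mulVec_sub, Matrix.mulVec_smul, sub_dotProduct, dotProduct_sub,
      smul_dotProduct, dotProduct_smul, smul_eq_mul, huu, hww, huw, hwu]
    norm_num
  · funext y
    ext i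
    simp only [reflVec, Function.comp, Matrix.mulVec_sub, Matrix.mulVec_smul, sub_dotProduct,
      dotProduct_sub, smul_dotProduct, dotProduct_smul, smul_eq_mul, quu, qww, quw, qwu,
      Pi.sub_apply, Pi.smul_apply]
    ring
  · ext i
    simp only [reflVec, Matrix.mulVec_sub, sub_dotProduct,
      dotProduct_sub, smul_eq_mul, quu, qww, quw, qwu,
      Pi.sub_apply, Pi.smul_apply]
    ring
end

section
/- Let n ≥ 2 and let F ∈ M_n(ℤ) be a symmetric matrix, with bilinear form (x,y) := xᵗFy. Suppose u, w ∈ ℤⁿ satisfy (u,u) = (w,w) = −2 and (u,w) = −4. Then: (1) (u−w, u−w) = 4 and (u−3w, u−3w) = 4; (2) r_u ∘ r_w = r_{u−w} ∘ r_{u−3w} as linear maps on ℚⁿ; (3) r_{u−w}(u) = w. -/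
open Matrix

theorem stmt1 (n : ℕ) (hn : 2 ≤ n) (F : Matrix (Fin n) (Fin n) ℤ) (hF : F.IsSymm)
    (u w : Fin n → ℤ)
    (huu : u ⬝ᵥ F.mulVec u = -2) (hww : w ⬝ᵥ F.mulVec w = -2)
    (huw : u ⬝ᵥ F.mulVec w = -4) :
    ((u - w) ⬝ᵥ F.mulVec (u - w) = 4 ∧
      (u - (3 : ℤ) • w) ⬝ᵥ F.mulVec (u - (3 : ℤ) • w) = 4) ∧
    (reflVec (qm F) (qv u) ∘ reflVec (qm F) (qv w) =
      reflVec (qm F) (qv u - qv w) ∘ reflVec (qm F) (qv u - (3 : ℚ) • qv w)) ∧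
    reflVec (qm F) (qv u - qv w) (qv u) = qv w := by
  have hwu : w ⬝ᵥ F.mulVec u = -4 := by
    rw [← huw, dotProduct_mulVec, ← mulVec_transpose, hF.eq, dotProduct_comm]
  have key : ∀ x y : Fin n → ℤ,
      qv x ⬝ᵥ (qm F).mulVec (qv y) = ((x ⬝ᵥ F.mulVec y : ℤ) : ℚ) := by
    intro x y
    simp [qv, qm, dotProduct, mulVec]
  have quu : qv u ⬝ᵥ (qm F).mulVec (qv u) = -2 := by rw [key, huu]; norm_num
  have qww : qv w ⬝ᵥ (qm F).mulVec (qv w) = -2 := by rw [key, hww]; norm_num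
  have quw : qv u ⬝ᵥ (qm F).mulVec (qv w) = -4 := by rw [key, huw]; norm_num
  have qwu : qv w ⬝ᵥ (qm F).mulVec (qv u) = -4 := by rw [key, hwu]; norm_num
  refine ⟨⟨?_, ?_⟩, ?_, ?_⟩
  · simp only [mulVec_sub, sub_dotProduct, dotProduct_sub, huu, hww, huw, hwu]
    norm_num
  · simp only [mulVec_sub, mulVec_smul, sub_dotProduct, dotProduct_sub, smul_dotProduct,
      dotProduct_smul, huu, hww, huw, hwu, smul_eq_mul]
    norm_num
  · funext y
    simp only [Function.comp, reflVec, mulVec_sub, mulVec_smul, sub_dotProduct, dotProduct_sub,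
      smul_dotProduct, dotProduct_smul, quu, qww, quw, qwu, smul_eq_mul]
    funext i
    simp only [Pi.sub_apply, Pi.smul_apply, smul_eq_mul]
    ring
  · simp only [reflVec, mulVec_sub, sub_dotProduct, dotProduct_sub, quu, qww, quw, qwu]
    funext i
    simp only [Pi.sub_apply, Pi.smul_apply, smul_eq_mul]
    ring
end

section
/- Let F ∈ M_n(ℤ) be symmetric with xᵗFx even for every x ∈ ℤⁿ (F is an even form). Suppose w₁, …, w_m ∈ ℤⁿ satisfy wᵢᵗFwᵢ = −2 for all i and wᵢᵗFw_{i+1} = −3 for 1 ≤ i ≤ m−1 (a path in the minimal distance graph). Then the product r_{w₁} ∘ r_{w_m} lies in the subgroup of GL_n(ℚ) generated by the reflections {r_x : x ∈ ℤⁿ, xᵗFx = 2}. In particular, the Cartan involutions r_u attached to vertices u of one connected component of the minimal distance graph all map to the same nontrivial coset (or the trivial coset) of the 2-reflection subgroup. -/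
open Matrix

/-- The matrix of the reflection `r_v : y ↦ y - (2 (v,y)/(v,v)) v` in the root `v`,
with respect to the bilinear form `(x,y) = xᵗ F y`. -/
def reflMat {n : ℕ} (F : Matrix (Fin n) (Fin n) ℚ) (v : Fin n → ℚ) :
    Matrix (Fin n) (Fin n) ℚ :=
  1 - (2 / (v ⬝ᵥ F.mulVec v)) • vecMulVec v (Fᵀ.mulVec v)

theorem cast_form {n : ℕ} (F : Matrix (Fin n) (Fin n) ℤ) (x y : Fin n → ℤ) :
    qv x ⬝ᵥ (qm F).mulVec (qv y) = ((x ⬝ᵥ F.mulVec y : ℤ) : ℚ) := by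
  simp [qv, qm, dotProduct, mulVec]

theorem form_comm {n : ℕ} (F : Matrix (Fin n) (Fin n) ℤ) (hF : F.IsSymm) (x y : Fin n → ℤ) :
    x ⬝ᵥ F.mulVec y = y ⬝ᵥ F.mulVec x := by
  rw [dotProduct_mulVec, ← mulVec_transpose, hF.eq, dotProduct_comm]

theorem cast_form' {n : ℕ} (F : Matrix (Fin n) (Fin n) ℤ) (hF : F.IsSymm) (x y : Fin n → ℤ) :
    (qm F)ᵀ.mulVec (qv x) ⬝ᵥ qv y = ((x ⬝ᵥ F.mulVec y : ℤ) : ℚ) := by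
  rw [← cast_form, mulVec_transpose, dotProduct_mulVec]

theorem refl_sq {n : ℕ} (F : Matrix (Fin n) (Fin n) ℤ) (hF : F.IsSymm) (x : Fin n → ℤ)
    (hx : x ⬝ᵥ F.mulVec x ≠ 0) :
    reflMat (qm F) (qv x) * reflMat (qm F) (qv x) = 1 := by
  have hx' : ((x ⬝ᵥ F.mulVec x : ℤ) : ℚ) ≠ 0 := by exact_mod_cast hx
  unfold reflMat
  rw [cast_form]
  have h := cast_form' F hF x x
  generalize (qm F)ᵀ.mulVec (qv x) = f at *
  generalize ((x ⬝ᵥ F.mulVec x : ℤ) : ℚ) = c at *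
  simp only [sub_mul, mul_sub, one_mul, mul_one, smul_mul_assoc, mul_smul_comm,
    vecMulVec_mul_vecMulVec, h]
  ext i j
  simp [vecMulVec_apply]
  field_simp
  ring

theorem refl_pair {n : ℕ} (F : Matrix (Fin n) (Fin n) ℤ) (hF : F.IsSymm) (u v : Fin n → ℤ)
    (hu : u ⬝ᵥ F.mulVec u = -2) (hv : v ⬝ᵥ F.mulVec v = -2) (huv : u ⬝ᵥ F.mulVec v = -3) :
    (u + u - v) ⬝ᵥ F.mulVec (u + u - v) = 2 ∧ (u - v) ⬝ᵥ F.mulVec (u - v) = 2 ∧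
    reflMat (qm F) (qv u) * reflMat (qm F) (qv v) =
      reflMat (qm F) (qv (u + u - v)) * reflMat (qm F) (qv (u - v)) := by
  have hvu := form_comm F hF u v
  rw [huv] at hvu
  have h1 : (u + u - v) ⬝ᵥ F.mulVec (u + u - v) = 2 := by
    simp [mulVec_add, mulVec_sub, hu, hv, huv, ← hvu]
  have h2 : (u - v) ⬝ᵥ F.mulVec (u - v) = 2 := by
    simp [mulVec_sub, hu, hv, huv, ← hvu]
  refine ⟨h1, h2, ?_⟩
  unfold reflMat
  simp only [cast_form, h1, h2, hu, hv]
  have e1 : qv (u + u - v) = qv u + qv u - qv v := by ext; simp [qv]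
  have e2 : qv (u - v) = qv u - qv v := by ext; simp [qv]
  rw [e1, e2]
  simp only [mulVec_add, mulVec_sub]
  have a1 := cast_form' F hF u u
  have a2 := cast_form' F hF u v
  have a3 := cast_form' F hF v u
  have a4 := cast_form' F hF v v
  rw [hu] at a1
  rw [huv] at a2
  rw [← hvu] at a3
  rw [hv] at a4
  generalize (qm F)ᵀ.mulVec (qv u) = f at *
  generalize (qm F)ᵀ.mulVec (qv v) = g at *
  simp only [sub_mul, mul_sub, one_mul, mul_one, smul_mul_assoc, mul_smul_comm,
    vecMulVec_mul_vecMulVec, add_dotProduct, sub_dotProduct, dotProduct_add, dotProduct_sub,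
    a1, a2, a3, a4]
  ext i j
  simp [vecMulVec_apply]
  ring

theorem stmt3 (n m : ℕ) (hm : 1 ≤ m)
    (F : Matrix (Fin n) (Fin n) ℤ) (hF : F.IsSymm)
    (heven : ∀ x : Fin n → ℤ, Even (x ⬝ᵥ F.mulVec x))
    (w : ℕ → Fin n → ℤ)
    (hnorm : ∀ i, i < m → (w i) ⬝ᵥ F.mulVec (w i) = -2)
    (hadj : ∀ i, i + 1 < m → (w i) ⬝ᵥ F.mulVec (w (i + 1)) = -3) :
    ∃ g ∈ Subgroup.closure
        {g : (Matrix (Fin n) (Fin n) ℚ)ˣ | ∃ x : Fin n → ℤ,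
          x ⬝ᵥ F.mulVec x = 2 ∧ (g : Matrix (Fin n) (Fin n) ℚ) = reflMat (qm F) (qv x)},
      (g : Matrix (Fin n) (Fin n) ℚ) =
        reflMat (qm F) (qv (w 0)) * reflMat (qm F) (qv (w (m - 1))) := by
  have key : ∀ k, k < m → ∃ g ∈ Subgroup.closure
        {g : (Matrix (Fin n) (Fin n) ℚ)ˣ | ∃ x : Fin n → ℤ,
          x ⬝ᵥ F.mulVec x = 2 ∧ (g : Matrix (Fin n) (Fin n) ℚ) = reflMat (qm F) (qv x)},
      (g : Matrix (Fin n) (Fin n) ℚ) =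
        reflMat (qm F) (qv (w 0)) * reflMat (qm F) (qv (w k)) := by
    intro k
    induction k with
    | zero =>
      intro h0
      refine ⟨1, Subgroup.one_mem _, ?_⟩
      rw [refl_sq F hF _ (by rw [hnorm 0 h0]; norm_num)]
      rfl
    | succ k ih =>
      intro hk
      obtain ⟨g, hg, hge⟩ := ih (by omega)
      obtain ⟨h1, h2, h3⟩ := refl_pair F hF (w k) (w (k + 1)) (hnorm k (by omega))
        (hnorm _ hk) (hadj k hk)
      have s1 := refl_sq F hF _ (show _ ≠ (0 : ℤ) by rw [h1]; norm_num)
      have s2 := refl_sq F hF _ (show _ ≠ (0 : ℤ) by rw [h2]; norm_num)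
      have s3 := refl_sq F hF (w k) (by rw [hnorm k (by omega)]; norm_num)
      refine ⟨g * (⟨_, _, s1, s1⟩ * ⟨_, _, s2, s2⟩), Subgroup.mul_mem _ hg
        (Subgroup.mul_mem _ (Subgroup.subset_closure ⟨_, h1, rfl⟩)
          (Subgroup.subset_closure ⟨_, h2, rfl⟩)), ?_⟩
      rw [Units.val_mul, Units.val_mul, hge]
      change _ * (reflMat (qm F) (qv (w k + w k - w (k + 1))) *
        reflMat (qm F) (qv (w k - w (k + 1)))) = _
      rw [← h3, mul_assoc, ← mul_assoc (reflMat (qm F) (qv (w k))), s3, one_mul]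
  exact key (m - 1) (by omega)
end

section
/- Let n ≥ 2 and let A ∈ GL_n(ℤ) be the Levelt companion matrix of P(x) = xⁿ + a₁xⁿ⁻¹ + ⋯ + a_{n−1}x + 1, where the coefficients are palindromic: aᵢ = a_{n−i} for all 1 ≤ i ≤ n−1 (equivalently, P is reciprocal, which holds whenever P is a product of cyclotomic polynomials). Set Ã := (Aᵗ)⁻¹. Then for any f ∈ M_n(ℤ): AᵗfA = f if and only if Ã^{i−1}(f·e₁) = f·eᵢ for every 2 ≤ i ≤ n, where e₁, …, e_n is the standard basis of ℤⁿ. -/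
open Matrix

/-- The Levelt companion matrix of the monic polynomial
`xⁿ + c 1 * xⁿ⁻¹ + ⋯ + c (n-1) * x + c n`: it has `1`'s in positions `(i+1, i)`,
last column `(-c n, -c (n-1), …, -c 1)ᵗ`, and zeros elsewhere. -/
def levelt (n : ℕ) (c : ℕ → ℤ) : Matrix (Fin n) (Fin n) ℤ :=
  Matrix.of fun i j =>
    if (j : ℕ) = n - 1 then -c (n - (i : ℕ))
    else if (i : ℕ) = (j : ℕ) + 1 then 1 else 0

def ee (n k : ℕ) : Fin n → ℤ := fun i => if (i : ℕ) = k then 1 else 0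

theorem ee_eq (n : ℕ) (i : Fin n) : (Pi.single i 1 : Fin n → ℤ) = ee n i := by
  funext j
  simp [ee, Pi.single_apply, Fin.ext_iff]

theorem lev_ee (n : ℕ) (a : ℕ → ℤ) (k : ℕ) (hk : k + 1 < n) :
    (levelt n a).mulVec (ee n k) = ee n (k+1) := by
  have h := ee_eq n ⟨k, by omega⟩
  simp only at h
  rw [← h, Matrix.mulVec_single_one]
  funext i
  have : ¬ (k = n - 1) := by omega
  simp [levelt, ee, this]

theorem lev_last (n : ℕ) (hn : 2 ≤ n) (a : ℕ → ℤ) :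
    (levelt n a).mulVec (ee n (n-1)) = - ∑ i ∈ Finset.range n, a (n - i) • ee n i := by
  have h := ee_eq n ⟨n-1, by omega⟩
  simp only at h
  rw [← h, Matrix.mulVec_single_one]
  funext i
  simp [levelt, ee, Finset.sum_apply]

theorem lev_pow (n : ℕ) (a : ℕ → ℤ) (k : ℕ) (hk : k < n) :
    (levelt n a ^ k).mulVec (ee n 0) = ee n k := by
  induction k with
  | zero => simp
  | succ k ih =>
    rw [pow_succ', ← Matrix.mulVec_mulVec, ih (by omega), lev_ee n a k hk]

theorem mat_ext (n : ℕ) (M N : Matrix (Fin n) (Fin n) ℤ)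
    (h : ∀ k < n, M.mulVec (ee n k) = N.mulVec (ee n k)) : M = N := by
  ext i j
  have := congrFun (h j j.2) i
  rw [← ee_eq, Matrix.mulVec_single_one, Matrix.mulVec_single_one] at this
  simpa using this

theorem lev_ch (n : ℕ) (hn : 2 ≤ n) (a : ℕ → ℤ) :
    levelt n a ^ n + ∑ i ∈ Finset.range n, a (n - i) • levelt n a ^ i = 0 := by
  have h0 : (levelt n a ^ n + ∑ i ∈ Finset.range n, a (n - i) • levelt n a ^ i).mulVec (ee n 0)
      = 0 := by
    rw [Matrix.add_mulVec, Matrix.sum_mulVec]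
    have h1 : (levelt n a ^ n).mulVec (ee n 0)
        = - ∑ i ∈ Finset.range n, a (n - i) • ee n i := by
      obtain ⟨m, rfl⟩ : ∃ m, n = m + 1 := ⟨n - 1, by omega⟩
      rw [pow_succ', ← Matrix.mulVec_mulVec, lev_pow _ a m (by omega)]
      exact lev_last (m+1) hn a
    rw [h1, neg_add_eq_zero]
    refine Finset.sum_congr rfl fun i hi => ?_
    rw [Matrix.smul_mulVec, lev_pow n a i (Finset.mem_range.1 hi)]
  apply mat_ext
  intro k hk
  rw [← lev_pow n a k hk, Matrix.mulVec_mulVec]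
  have hc : Commute (levelt n a ^ n + ∑ i ∈ Finset.range n, a (n - i) • levelt n a ^ i)
      (levelt n a ^ k) := by
    refine Commute.add_left (Commute.pow_pow_self _ _ _) (Commute.sum_left _ _ _ fun i _ => ?_)
    exact (Commute.pow_pow_self _ _ _).smul_left _
  rw [hc.eq, ← Matrix.mulVec_mulVec, h0]
  simp

theorem stmt6 (n : ℕ) (hn : 2 ≤ n) (a : ℕ → ℤ) (han : a n = 1)
    (hpal : ∀ i, 1 ≤ i → i ≤ n - 1 → a i = a (n - i))
    (f : Matrix (Fin n) (Fin n) ℤ) :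
    (levelt n a)ᵀ * f * levelt n a = f ↔
      ∀ i : Fin n, 1 ≤ (i : ℕ) →
        (((levelt n a)ᵀ)⁻¹ ^ (i : ℕ)).mulVec (f.mulVec (Pi.single (⟨0, by omega⟩ : Fin n) 1))
          = f.mulVec (Pi.single i 1) := by
  have hch := lev_ch n hn a
  have hT : (levelt n a)ᵀ ^ n + ∑ i ∈ Finset.range n, a (n - i) • (levelt n a)ᵀ ^ i = 0 := by
    have := congrArg Matrix.transpose hch
    simpa only [Matrix.transpose_add, Matrix.transpose_smul, Matrix.transpose_zero,
      Matrix.transpose_sum, Matrix.transpose_pow] using this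
  set A := levelt n a with hA
  set T := Aᵀ with hTdef
  obtain ⟨m, rfl⟩ : ∃ m, n = m + 1 := ⟨n - 1, by omega⟩
  have hinv : T * (-(T ^ m + ∑ i ∈ Finset.range m, a (m - i) • T ^ i)) = 1 := by
    rw [Finset.sum_range_succ'] at hT
    simp only [Nat.sub_zero, pow_zero, han, one_smul, Nat.add_sub_add_right] at hT
    rw [mul_neg, mul_add, ← pow_succ', Finset.mul_sum]
    simp only [mul_smul_comm, ← pow_succ']
    rw [← add_assoc] at hT
    rw [eq_neg_of_add_eq_zero_left hT, neg_neg]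
  have hdet : IsUnit T.det := Matrix.isUnit_det_of_right_inverse hinv
  set B := T⁻¹ with hB
  have hBT : B * T = 1 := Matrix.nonsing_inv_mul T hdet
  have hTB : T * B = 1 := Matrix.mul_nonsing_inv T hdet
  have hcomm : Commute B T := by rw [Commute, SemiconjBy, hBT, hTB]
  have hBTp : ∀ k, B ^ k * T ^ k = 1 := fun k => by rw [← hcomm.mul_pow, hBT, one_pow]
  have hPB : B ^ (m+1) + ∑ i ∈ Finset.range (m+1), a (m + 1 - i) • B ^ i = 0 := by
    have h1 := congrArg (B ^ (m+1) * ·) hT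
    simp only [mul_add, hBTp, Finset.mul_sum, mul_smul_comm, mul_zero] at h1
    have h2 : ∀ i ∈ Finset.range (m+1), a (m+1-i) • (B^(m+1) * T^i)
        = a (m+1-i) • B^(m+1-i) := by
      intro i hi
      have hi := Finset.mem_range.1 hi
      have : B^(m+1) = B^(m+1-i) * B^i := by rw [← pow_add]; congr 1; omega
      rw [this, mul_assoc, hBTp, mul_one]
    rw [Finset.sum_congr rfl h2, Finset.sum_range_succ'] at h1
    rw [Finset.sum_range_succ', ← h1, ← Finset.sum_range_reflect]
    simp only [Nat.sub_zero, han, one_smul, pow_zero]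
    have h3 : ∀ j ∈ Finset.range m, a (m + 1 - (m - 1 - j + 1)) • B ^ (m - 1 - j + 1)
        = a (m + 1 - (j+1)) • B ^ (m + 1 - (j+1)) := by
      intro j hj
      have hj := Finset.mem_range.1 hj
      have e1 : m - 1 - j + 1 = m + 1 - (j+1) := by omega
      rw [e1, ← hpal (m+1-(j+1)) (by omega) (by omega)]
    rw [Finset.sum_congr rfl h3]
    abel
  have key : T * f * A = f ↔ f * A = B * f := by
    constructor
    · intro h
      calc f * A = B * T * (f * A) := by rw [hBT, one_mul]
        _ = B * (T * f * A) := by simp only [mul_assoc]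
        _ = B * f := by rw [h]
    · intro h
      rw [mul_assoc, h, ← mul_assoc, hTB, one_mul]
  rw [key]
  simp only [ee_eq]
  constructor
  · intro h i _
    have : ∀ k, k < m + 1 → (B^k).mulVec (f.mulVec (ee (m+1) 0)) = f.mulVec (ee (m+1) k) := by
      intro k
      induction k with
      | zero => simp
      | succ k ih =>
        intro hk
        rw [pow_succ', ← Matrix.mulVec_mulVec, ih (by omega), Matrix.mulVec_mulVec, ← h,
          ← Matrix.mulVec_mulVec, lev_ee _ a k hk]
    exact this i i.2
  · intro h
    have h' : ∀ k, k < m + 1 → f.mulVec (ee (m+1) k) = (B^k).mulVec (f.mulVec (ee (m+1) 0)) := by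
      intro k hk
      rcases Nat.eq_zero_or_pos k with rfl | hp
      · simp
      · exact (h ⟨k, hk⟩ hp).symm
    apply mat_ext
    intro k hk
    rw [← Matrix.mulVec_mulVec, ← Matrix.mulVec_mulVec, h' k hk,
      Matrix.mulVec_mulVec _ B (B ^ k), ← pow_succ']
    by_cases hkm : k = m
    · subst hkm
      have hl := lev_last (k+1) hn a
      simp only [Nat.add_sub_cancel] at hl
      rw [hA, hl, eq_neg_of_add_eq_zero_left hPB, Matrix.mulVec_neg, Matrix.neg_mulVec,
        Matrix.mulVec_sum, Matrix.sum_mulVec]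
      congr 1
      refine Finset.sum_congr rfl fun i hi => ?_
      rw [Matrix.mulVec_smul, Matrix.smul_mulVec, h' i (Finset.mem_range.1 hi)]
    · rw [hA, lev_ee _ a k (by omega), h' (k+1) (by omega)]
end

section
/- Let n ≥ 2. Let A ∈ GL_n(ℤ) be the Levelt companion matrix of P(x) = xⁿ + a₁xⁿ⁻¹ + ⋯ + a_{n−1}x + 1 with palindromic coefficients aᵢ = a_{n−i}, and let B ∈ GL_n(ℤ) be the Levelt companion matrix of Q(x) = xⁿ + b₁xⁿ⁻¹ + ⋯ + b_{n−1}x − 1 with anti-palindromic coefficients b_{n−i} = −bᵢ (these coefficient conditions hold whenever P and Q are products of cyclotomic polynomials). Set v := (a_{n−1}+b_{n−1}, a_{n−2}+b_{n−2}, …, a₁+b₁, 2)ᵗ ∈ ℤⁿ. Let f ∈ M_n(ℤ) satisfy AᵗfA = f. Then: (a) BᵗfB = f if and only if the Euclidean dot product of B^{2−i}v with f·e₁ is zero for every 2 ≤ i ≤ n; (b) if moreover BᵗfB = f, then the Euclidean dot product of v with f·eᵢ is zero for every 1 ≤ i ≤ n−1. -/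
open Matrix

/-- The vector `v = (a_{n-1}+b_{n-1}, a_{n-2}+b_{n-2}, …, a₁+b₁, 2)ᵗ`. -/
def vvec (n : ℕ) (a b : ℕ → ℤ) : Fin n → ℤ :=
  fun i => if (i : ℕ) = n - 1 then 2 else a (n - 1 - (i : ℕ)) + b (n - 1 - (i : ℕ))

theorem lev_zero (m : ℕ) (c : ℕ → ℤ) (x : Fin (m+1) → ℤ) :
    (levelt (m+1) c *ᵥ x) 0 = - c (m+1) * x (Fin.last m) := by
  simp [Matrix.mulVec, dotProduct, Fin.sum_univ_castSucc, levelt]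
  refine Finset.sum_eq_zero fun i _ => ?_
  simp [i.isLt.ne]

theorem lev_succ (m : ℕ) (c : ℕ → ℤ) (x : Fin (m+1) → ℤ) (i : Fin m) :
    (levelt (m+1) c *ᵥ x) i.succ = x i.castSucc - c (m - i) * x (Fin.last m) := by
  have : ∀ j : Fin m, levelt (m+1) c i.succ j.castSucc = if i = j then 1 else 0 := by
    intro j
    simp [levelt, j.isLt.ne, Fin.ext_iff]
  simp only [Matrix.mulVec, dotProduct, Fin.sum_univ_castSucc, this]
  simp [levelt]
  ring

theorem lev_unit (m : ℕ) (c : ℕ → ℤ) (hc : c (m+1) * c (m+1) = 1) :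
    IsUnit (levelt (m+1) c) := by
  rw [← Matrix.mulVec_surjective_iff_isUnit]
  intro y
  refine ⟨Fin.snoc (α := fun _ => ℤ)
    (fun i : Fin m => y i.succ + c (m - i) * (- c (m+1) * y 0)) (- c (m+1) * y 0), ?_⟩
  funext i
  refine Fin.cases ?_ (fun i => ?_) i
  · rw [lev_zero, Fin.snoc_last]
    linear_combination y 0 * hc
  · rw [lev_succ, Fin.snoc_last, Fin.snoc_castSucc]
    ring

theorem lev_single (m : ℕ) (c : ℕ → ℤ) (j : Fin m) :
    levelt (m+1) c *ᵥ (Pi.single j.castSucc 1) = Pi.single j.succ 1 := by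
  funext i
  refine Fin.cases ?_ (fun i => ?_) i
  · rw [lev_zero]
    simp [Pi.single_apply, Fin.ext_iff, j.isLt.ne']
  · rw [lev_succ]
    simp [Pi.single_apply, Fin.ext_iff, j.isLt.ne']

theorem vv_last (m : ℕ) (a b : ℕ → ℤ) : vvec (m+1) a b (Fin.last m) = 2 := by
  simp [vvec]

theorem vv_cs (m : ℕ) (a b : ℕ → ℤ) (i : Fin m) :
    vvec (m+1) a b i.castSucc = a (m - i) + b (m - i) := by
  simp [vvec, i.isLt.ne]

theorem lev_v_neg (m : ℕ) (a b : ℕ → ℤ) (han : a (m+1) = 1) (hbn : b (m+1) = -1) :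
    levelt (m+1) b *ᵥ vvec (m+1) a b = - (levelt (m+1) a *ᵥ vvec (m+1) a b) := by
  funext i
  refine Fin.cases ?_ (fun i => ?_) i
  · simp [lev_zero, vv_last, han, hbn]
  · simp only [Pi.neg_apply, lev_succ, vv_last, vv_cs]
    ring

theorem lev_diff (m : ℕ) (a b : ℕ → ℤ) (han : a (m+1) = 1) (hbn : b (m+1) = -1)
    (x : Fin (m+1) → ℤ) :
    levelt (m+1) b *ᵥ x =
      levelt (m+1) a *ᵥ (x - x (Fin.last m) • vvec (m+1) a b) := by
  funext i
  refine Fin.cases ?_ (fun i => ?_) i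
  · simp [lev_zero, vv_last, han, hbn]; ring
  · simp only [lev_succ, Pi.sub_apply, Pi.smul_apply, smul_eq_mul, vv_last, vv_cs]
    ring

theorem vv_rev (m : ℕ) (a b : ℕ → ℤ) (han : a (m+1) = 1) 
    (hpal : ∀ i, 1 ≤ i → i ≤ m → a i = a (m + 1 - i))
    (hanti : ∀ i, 1 ≤ i → i ≤ m → b (m + 1 - i) = -b i) (j : Fin (m+1)) :
    vvec (m+1) a b j.rev = - (levelt (m+1) a *ᵥ vvec (m+1) a b) j := by
  refine Fin.cases ?_ (fun i => ?_) j
  · rw [lev_zero, Fin.rev_zero, vv_last, han]; norm_num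
  · rw [lev_succ, Fin.rev_succ, vv_cs, vv_cs, vv_last]
    have hi := i.isLt
    have e : m - (i.rev : ℕ) = i + 1 := by rw [Fin.val_rev]; omega
    have h1 := hpal (i+1) (by omega) (by omega)
    have h2 := hanti (i+1) (by omega) (by omega)
    have e2 : m + 1 - ((i:ℕ) + 1) = m - i := by omega
    rw [e2] at h1 h2
    rw [e, h1, h2]; ring

theorem form_inv {n : ℕ} (M f : Matrix (Fin n) (Fin n) ℤ) (h : Mᵀ * f * M = f)
    (x y : Fin n → ℤ) : (M *ᵥ x) ⬝ᵥ f *ᵥ (M *ᵥ y) = x ⬝ᵥ f *ᵥ y := by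
  conv_rhs => rw [← h]
  rw [← Matrix.mulVec_mulVec, ← Matrix.mulVec_mulVec, Matrix.dotProduct_mulVec x Mᵀ,
    Matrix.vecMul_transpose]

theorem form_single {n : ℕ} (f : Matrix (Fin n) (Fin n) ℤ) (i j : Fin n) :
    (Pi.single i 1) ⬝ᵥ f *ᵥ (Pi.single j 1) = f i j := by
  simp

theorem of_form {n : ℕ} (M f : Matrix (Fin n) (Fin n) ℤ)
    (h : ∀ i j, (M *ᵥ Pi.single i 1) ⬝ᵥ f *ᵥ (M *ᵥ Pi.single j 1) = f i j) :
    Mᵀ * f * M = f := by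
  ext i j
  rw [← h i j, ← form_single (Mᵀ * f * M) i j]
  rw [← Matrix.mulVec_mulVec, ← Matrix.mulVec_mulVec, Matrix.dotProduct_mulVec _ Mᵀ,
    Matrix.vecMul_transpose]

theorem persymm (m : ℕ) (f : Matrix (Fin (m+1)) (Fin (m+1)) ℤ)
    (h : ∀ i j : Fin m, f i.succ j.succ = f i.castSucc j.castSucc) (i j : Fin (m+1)) :
    f i j = f j.rev i.rev := by
  have key : ∀ k (i j : ℕ) (hi : i + k < m + 1) (hj : j + k < m + 1),
      f ⟨i + k, hi⟩ ⟨j + k, hj⟩ = f ⟨i, by omega⟩ ⟨j, by omega⟩ := by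
    intro k
    induction k with
    | zero => intros; rfl
    | succ k ih =>
      intro i j hi hj
      rw [← ih i j (by omega) (by omega)]
      exact h ⟨i + k, by omega⟩ ⟨j + k, by omega⟩
  have hi := i.isLt
  have hj := j.isLt
  rcases le_total ((i : ℕ) + j) m with hl | hl
  · have := key (m - (i + j)) i j (by omega) (by omega)
    rw [show i = ⟨i, hi⟩ from rfl, show j = ⟨j, hj⟩ from rfl, ← this]
    congr 1 <;> (ext; simp [Fin.val_rev]; omega)
  · have := key (i + j - m) (j.rev : ℕ) (i.rev : ℕ) (by rw [Fin.val_rev]; omega)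
      (by rw [Fin.val_rev]; omega)
    refine Eq.trans ?_ this
    congr 1 <;> (ext; simp [Fin.val_rev]; omega)

theorem back (m : ℕ) (a b : ℕ → ℤ) (han : a (m+1) = 1) (hbn : b (m+1) = -1)
    (hpal : ∀ i, 1 ≤ i → i ≤ m → a i = a (m + 1 - i))
    (hanti : ∀ i, 1 ≤ i → i ≤ m → b (m + 1 - i) = -b i)
    (f : Matrix (Fin (m+1)) (Fin (m+1)) ℤ)
    (hfA : (levelt (m+1) a)ᵀ * f * levelt (m+1) a = f)
    (hv : ∀ k : Fin m, vvec (m+1) a b ⬝ᵥ f *ᵥ Pi.single k.castSucc 1 = 0) :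
    (levelt (m+1) b)ᵀ * f * levelt (m+1) b = f := by
  have hA := form_inv _ _ hfA
  have hp := persymm m f (by
    intro i j
    rw [← form_single f i.succ, ← form_single f i.castSucc, ← lev_single m a, ← lev_single m a, hA])
  have hv' : ∀ k : Fin m, Pi.single k.castSucc 1 ⬝ᵥ f *ᵥ vvec (m+1) a b = 0 := by
    intro k
    have h1 := hv k.rev
    rw [← hA, lev_single] at h1
    have h2 : (Pi.single k.castSucc 1 : Fin (m+1) → ℤ) ⬝ᵥ f *ᵥ vvec (m+1) a b =
        -((levelt (m+1) a *ᵥ vvec (m+1) a b) ⬝ᵥ f *ᵥ Pi.single k.rev.succ 1) := by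
      rw [← neg_dotProduct]
      simp only [single_one_dotProduct, mulVec_single_one]
      simp only [Matrix.mulVec, dotProduct]
      rw [← Equiv.sum_comp Fin.revPerm]
      refine Finset.sum_congr rfl fun j _ => ?_
      rw [hp]
      simp only [Fin.revPerm_apply, vv_rev m a b han hpal hanti, Fin.rev_rev, Fin.rev_castSucc]
      simp [Matrix.col, Matrix.mulVec, dotProduct, mul_comm]
    rw [h2, h1, neg_zero]
  set v := vvec (m+1) a b with hvdef
  have hl : v (Fin.last m) = 2 := vv_last m a b
  have e1 : v ⬝ᵥ f *ᵥ v = 2 * (v ⬝ᵥ f *ᵥ Pi.single (Fin.last m) 1) := by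
    have : ∀ j, v ⬝ᵥ f *ᵥ Pi.single j 1 = (v ᵥ* f) j := by
      intro j; rw [Matrix.dotProduct_mulVec]; simp
    simp only [this] at hv ⊢
    rw [Matrix.dotProduct_mulVec, dotProduct, Fin.sum_univ_castSucc]
    simp [hv, hl, mul_comm]
  have e2 : v ⬝ᵥ f *ᵥ v = 2 * (Pi.single (Fin.last m) 1 ⬝ᵥ f *ᵥ v) := by
    simp only [single_one_dotProduct] at hv' ⊢
    rw [dotProduct, Fin.sum_univ_castSucc]
    simp [hv', hl]
  apply of_form
  intro i j
  rw [lev_diff m a b han hbn, lev_diff m a b han hbn, hA, ← form_single f i j]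
  simp only [← hvdef, Matrix.mulVec_sub, Matrix.mulVec_smul, sub_dotProduct, dotProduct_sub,
    smul_dotProduct, dotProduct_smul, smul_eq_mul]
  refine Fin.lastCases ?_ (fun i => ?_) i <;> refine Fin.lastCases ?_ (fun j => ?_) j
  · rw [Pi.single_eq_same]; linarith
  · rw [hv j, Pi.single_eq_of_ne (Fin.castSucc_lt_last j).ne']; ring
  · rw [hv' i, Pi.single_eq_of_ne (Fin.castSucc_lt_last i).ne']; ring
  · rw [Pi.single_eq_of_ne (Fin.castSucc_lt_last i).ne',
      Pi.single_eq_of_ne (Fin.castSucc_lt_last j).ne']; ring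

theorem stmt7 (n : ℕ) (hn : 2 ≤ n) (a b : ℕ → ℤ)
    (han : a n = 1) (hbn : b n = -1)
    (hpal : ∀ i, 1 ≤ i → i ≤ n - 1 → a i = a (n - i))
    (hanti : ∀ i, 1 ≤ i → i ≤ n - 1 → b (n - i) = -b i)
    (f : Matrix (Fin n) (Fin n) ℤ)
    (hfA : (levelt n a)ᵀ * f * levelt n a = f) :
    ((levelt n b)ᵀ * f * levelt n b = f ↔
      ∀ i : Fin n, 1 ≤ (i : ℕ) →
        ((levelt n b ^ ((1 : ℤ) - ((i : ℕ) : ℤ))).mulVec (vvec n a b)) ⬝ᵥ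
          f.mulVec (Pi.single (⟨0, by omega⟩ : Fin n) 1) = 0) ∧
    ((levelt n b)ᵀ * f * levelt n b = f →
      ∀ i : Fin n, (i : ℕ) ≤ n - 2 →
        vvec n a b ⬝ᵥ f.mulVec (Pi.single i 1) = 0) := by
  obtain ⟨m, rfl⟩ : ∃ m, n = m + 1 := ⟨n - 1, by omega⟩
  have hA := form_inv _ _ hfA
  have hb : (levelt (m+1) b)ᵀ * f * levelt (m+1) b = f →
      ∀ k : Fin m, vvec (m+1) a b ⬝ᵥ f *ᵥ Pi.single k.castSucc 1 = 0 := by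
    intro h k
    have h1 := form_inv _ _ h (vvec (m+1) a b) (Pi.single k.castSucc 1)
    have h2 := hA (vvec (m+1) a b) (Pi.single k.castSucc 1)
    rw [lev_single] at h1 h2
    rw [lev_v_neg m a b han hbn, neg_dotProduct, h2] at h1
    linarith
  have hu := (Matrix.isUnit_iff_isUnit_det _).1 (lev_unit m b (by rw [hbn]; norm_num))
  obtain ⟨u, hudef⟩ : ∃ u : ℕ → Fin (m+1) → ℤ,
    ∀ k, u k = (levelt (m+1) b ^ (-(k : ℤ))) *ᵥ vvec (m+1) a b := ⟨_, fun _ => rfl⟩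
  have hu0 : u 0 = vvec (m+1) a b := by simp [hudef]
  have hus : ∀ k, levelt (m+1) b *ᵥ u (k+1) = u k := by
    intro k
    rw [hudef, hudef, Matrix.mulVec_mulVec]
    congr 1
    rw [show -(k:ℤ) = 1 + -((k+1 : ℕ) : ℤ) by push_cast; ring, Matrix.zpow_add hu, zpow_one]
  have hui : ∀ i : ℕ, 1 ≤ i →
      levelt (m+1) b ^ ((1 : ℤ) - (i : ℤ)) *ᵥ vvec (m+1) a b = u (i - 1) := by
    intro i hi
    rw [hudef]; congr 2; omega
  refine ⟨⟨fun h i hi => ?_, fun h => ?_⟩, fun h i hi => ?_⟩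
  · rw [hui _ hi]
    have hB := form_inv _ _ h
    have key : ∀ k j (hj : k + j < m), u k ⬝ᵥ f *ᵥ Pi.single (⟨j, by omega⟩ : Fin (m+1)) 1 = 0 := by
      intro k
      induction k with
      | zero => intro j hj; rw [hu0]; exact hb h ⟨j, by omega⟩
      | succ k ih =>
        intro j hj
        have := ih (j+1) (by omega)
        rw [← hus, show (⟨j+1, by omega⟩ : Fin (m+1)) = (⟨j, by omega⟩ : Fin m).succ from rfl,
          ← lev_single m b, hB] at this
        exact this
    exact key _ 0 (by omega)
  · apply back m a b han hbn (by simpa using hpal) (by simpa using hanti) f hfA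
    have key : ∀ j k (hj : k + j < m), u k ⬝ᵥ f *ᵥ Pi.single (⟨j, by omega⟩ : Fin (m+1)) 1 = 0 := by
      intro j
      induction j with
      | zero =>
        intro k hj
        have := h ⟨k+1, by omega⟩ (by simp)
        rw [hui _ (by simp)] at this
        exact this
      | succ j ih =>
        intro k hj
        have h1 := ih (k+1) (by omega)
        have h2 := ih 0 (by omega)
        rw [← hus, show (⟨j+1, by omega⟩ : Fin (m+1)) = (⟨j, by omega⟩ : Fin m).succ from rfl,
          ← lev_single m a, lev_diff m a b han hbn, hA, sub_dotProduct, smul_dotProduct, ← hu0]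
        rw [show (⟨j, by omega⟩ : Fin m).castSucc = (⟨j, by omega⟩ : Fin (m+1)) from rfl, h1, h2]
        simp
    intro k
    rw [← hu0]
    exact key k 0 (by omega)
  · exact hb h ⟨i, by omega⟩
end

section
/- Let n ≥ 2. Let A ∈ GL_n(ℤ) be the Levelt companion matrix of P(x) = xⁿ + a₁xⁿ⁻¹ + ⋯ + a_{n−1}x + 1 and B ∈ GL_n(ℤ) the Levelt companion matrix of Q(x) = xⁿ + b₁xⁿ⁻¹ + ⋯ + b_{n−1}x − 1, and set v := (a_{n−1}+b_{n−1}, a_{n−2}+b_{n−2}, …, a₁+b₁, 2)ᵗ ∈ ℤⁿ. Let f ∈ M_n(ℚ) be a symmetric matrix with AᵗfA = f, BᵗfB = f, and vᵗfv = −2. Then for every u ∈ ℚⁿ, vᵗfu equals minus the n-th coordinate of u. -/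
open Matrix

theorem levelt_mulVec_aux (m : ℕ) (c : ℕ → ℤ) (x : Fin (m+1) → ℚ) (i : Fin (m+1)) :
    (qm (levelt (m+1) c)).mulVec x i
      = (∑ j : Fin m, if (i : ℕ) = (j : ℕ) + 1 then x j.castSucc else 0)
        - (c (m + 1 - (i : ℕ)) : ℚ) * x (Fin.last m) := by
  simp only [Matrix.mulVec, dotProduct, Fin.sum_univ_castSucc, qm, levelt, Matrix.map_apply,
    Matrix.of_apply]
  have : ∀ j : Fin m, (j : ℕ) ≠ m := fun j => j.2.ne
  simp [this, sub_eq_add_neg]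

theorem levelt_sum_aux (m : ℕ) (a b : ℕ → ℤ) (han : a (m+1) = 1) (hbn : b (m+1) = -1) :
    (qm (levelt (m+1) b)).mulVec (qv (vvec (m+1) a b))
      = -(qm (levelt (m+1) a)).mulVec (qv (vvec (m+1) a b)) := by
  funext i
  rw [Pi.neg_apply, levelt_mulVec_aux, levelt_mulVec_aux]
  have hl : qv (vvec (m+1) a b) (Fin.last m) = 2 := by simp [qv, vvec]
  rw [hl]
  refine Fin.cases ?_ (fun k => ?_) i
  · simp [han, hbn]
  · have : (∑ j : Fin m, if ((k.succ : Fin (m+1)) : ℕ) = (j : ℕ) + 1 then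
        qv (vvec (m+1) a b) j.castSucc else 0) = qv (vvec (m+1) a b) k.castSucc := by
      rw [Finset.sum_eq_single k]
      · simp
      · intro j _ hj
        rw [if_neg]
        intro h
        apply hj
        ext
        simp at h
        omega
      · simp
    rw [this]
    have hk : (k : ℕ) ≠ m := k.2.ne
    simp [qv, vvec, hk]
    ring

theorem form_inv_aux {n : ℕ} (f M : Matrix (Fin n) (Fin n) ℚ) (h : Mᵀ * f * M = f)
    (x y : Fin n → ℚ) : M.mulVec x ⬝ᵥ f.mulVec (M.mulVec y) = x ⬝ᵥ f.mulVec y := by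
  conv_rhs => rw [← h]
  rw [← Matrix.mulVec_mulVec, ← Matrix.mulVec_mulVec, Matrix.dotProduct_mulVec x,
    Matrix.vecMul_transpose]

theorem stmt8 (n : ℕ) (hn : 2 ≤ n) (a b : ℕ → ℤ)
    (han : a n = 1) (hbn : b n = -1)
    (f : Matrix (Fin n) (Fin n) ℚ) (hsymm : f.IsSymm)
    (hfA : (qm (levelt n a))ᵀ * f * qm (levelt n a) = f)
    (hfB : (qm (levelt n b))ᵀ * f * qm (levelt n b) = f)
    (hv : qv (vvec n a b) ⬝ᵥ f.mulVec (qv (vvec n a b)) = -2) :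
    ∀ u : Fin n → ℚ,
      qv (vvec n a b) ⬝ᵥ f.mulVec u = -u ⟨n - 1, by omega⟩ := by
  obtain ⟨m, rfl⟩ : ∃ m, n = m + 1 := ⟨n - 1, by omega⟩
  have hs := levelt_sum_aux m a b han hbn
  have hw : qv (vvec (m+1) a b) (Fin.last m) = 2 := by simp [qv, vvec]
  generalize qv (vvec (m+1) a b) = w at *
  have key : ∀ x : Fin (m+1) → ℚ, x (Fin.last m) = 0 → w ⬝ᵥ f.mulVec x = 0 := by
    intro x hx
    have hAB : (qm (levelt (m+1) b)).mulVec x = (qm (levelt (m+1) a)).mulVec x := by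
      funext i
      rw [levelt_mulVec_aux, levelt_mulVec_aux, hx]
      simp
    have h1 := form_inv_aux f _ hfA w x
    have h2 := form_inv_aux f _ hfB w x
    rw [hAB, hs, neg_dotProduct, h1] at h2
    linarith
  intro u
  have h := key (u - (u (Fin.last m) / 2) • w) (by simp [hw])
  rw [Matrix.mulVec_sub, Matrix.mulVec_smul, dotProduct_sub, dotProduct_smul, hv] at h
  have e : (⟨m + 1 - 1, by omega⟩ : Fin (m+1)) = Fin.last m := by ext; simp
  rw [e]
  simp only [smul_eq_mul] at h
  linarith
end

section
/- Let n ≥ 5 be odd. Let A ∈ GL_n(ℤ) be the Levelt companion matrix of P(x) = xⁿ + 2xⁿ⁻¹ + 2xⁿ⁻² + ⋯ + 2x + 1 (all middle coefficients equal to 2) and let B ∈ GL_n(ℤ) be the Levelt companion matrix of Q(x) = xⁿ − xⁿ⁻¹ + xⁿ⁻² − ⋯ + x − 1 (coefficients alternating (−1)^i). Set v := (a_{n−1}+b_{n−1}, …, a₁+b₁, 2)ᵗ where aᵢ = 2 and bᵢ = (−1)^i. Let f ∈ M_n(ℚ) be symmetric with AᵗfA = f, BᵗfB = f, and vᵗfv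 = −2. Then for all 0 ≤ i, j ≤ n−1: (B^i v)ᵗ f (B^j v) equals −2 if i = j; equals −3 if |i − j| = 1; and equals −4 if |i − j| ≥ 2. (This is the normalized invariant quadratic form of the hyperbolic hypergeometric monodromy group of the family 𝒩₁(1,n,n).) -/
open Matrix

/-- Coefficients of `P(x) = xⁿ + 2xⁿ⁻¹ + 2xⁿ⁻² + ⋯ + 2x + 1`. -/
def cP10 (n : ℕ) : ℕ → ℤ := fun k => if k = n then 1 else 2

/-- Coefficients of `Q(x) = xⁿ - xⁿ⁻¹ + xⁿ⁻² - ⋯ + x - 1` (for odd `n`). -/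
def cQalt : ℕ → ℤ := fun k => (-1) ^ k

theorem lev_mul (m : ℕ) (c : ℕ → ℤ) (u : ℕ → ℚ) (i : Fin (m+1)) :
    (qm (levelt (m+1) c)).mulVec (fun k => u k) i =
      (if (i:ℕ) = 0 then 0 else u ((i:ℕ) - 1)) - (c (m + 1 - (i:ℕ)) : ℚ) * u m := by
  simp only [mulVec, dotProduct, qm, levelt, Matrix.map_apply, Matrix.of_apply]
  rw [Fin.sum_univ_castSucc]
  have h1 : ∀ k : Fin m, ((k.castSucc : Fin (m+1)) : ℕ) ≠ m + 1 - 1 := by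
    intro k; have := k.2; simp; omega
  simp only [h1, if_false]
  have h2 : (((Fin.last m : Fin (m+1)) : ℕ) = m + 1 - 1) := by simp
  simp only [h2, if_true]
  have : (∑ x : Fin m, (((if (i:ℕ) = ((x.castSucc : Fin (m+1)) : ℕ) + 1 then (1:ℤ) else 0 : ℤ)) : ℚ)
      * u ((x.castSucc : Fin (m+1)) : ℕ)) = if (i:ℕ) = 0 then 0 else u ((i:ℕ) - 1) := by
    split_ifs with h0
    · apply Finset.sum_eq_zero
      intro x _
      simp [h0]
    · have hi := i.2
      rw [Finset.sum_eq_single (⟨(i:ℕ) - 1, by omega⟩ : Fin m)]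
      · have : (i:ℕ) = (i:ℕ) - 1 + 1 := by omega
        simp [← this]
      · intro b _ hb
        have : (i:ℕ) ≠ (b:ℕ) + 1 := by
          intro h; apply hb; ext; simp; omega
        simp [this]
      · simp
  rw [this]
  push_cast
  simp
  ring

theorem inv_form {n : ℕ} (M f : Matrix (Fin n) (Fin n) ℚ) (h : Mᵀ * f * M = f)
    (x y : Fin n → ℚ) : (M.mulVec x) ⬝ᵥ f.mulVec (M.mulVec y) = x ⬝ᵥ f.mulVec y := by
  conv_rhs => rw [← h]
  rw [← Matrix.mulVec_mulVec, ← Matrix.mulVec_mulVec, Matrix.dotProduct_mulVec x,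
    Matrix.vecMul_transpose]

theorem inv_form_pow {n : ℕ} (M f : Matrix (Fin n) (Fin n) ℚ) (h : Mᵀ * f * M = f)
    (x y : Fin n → ℚ) (k : ℕ) :
    ((M ^ k).mulVec x) ⬝ᵥ f.mulVec ((M ^ k).mulVec y) = x ⬝ᵥ f.mulVec y := by
  induction k with
  | zero => simp
  | succ k ih =>
    rw [pow_succ', ← Matrix.mulVec_mulVec, ← Matrix.mulVec_mulVec, inv_form M f h, ih]

/-- explicit coordinates of `v` -/
def vc (m : ℕ) : ℕ → ℚ := fun i => if i = m then 2 else 2 + (-1) ^ i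

theorem v_eq (m : ℕ) (hm : Even m) :
    qv (vvec (m+1) (cP10 (m+1)) cQalt) = fun k : Fin (m+1) => vc m k := by
  ext k
  have hk := k.2
  simp only [qv, vvec, vc, cP10, cQalt, Nat.add_sub_cancel]
  split_ifs with h1 h2
  · simp
  · omega
  · push_cast
    congr 1
    rcases Nat.even_or_odd (k:ℕ) with h | h
    · rw [h.neg_one_pow, Even.neg_one_pow]
      grind
    · rw [h.neg_one_pow, Odd.neg_one_pow]
      grind

theorem cQ_eq (m : ℕ) (hm : Even m) (i : ℕ) (hi : i ≤ m) :
    ((cQalt (m + 1 - i) : ℤ) : ℚ) = - (-1) ^ i := by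
  simp only [cQalt]
  push_cast
  rcases Nat.even_or_odd i with h | h
  · rw [h.neg_one_pow, Odd.neg_one_pow]
    grind
  · rw [h.neg_one_pow, Even.neg_one_pow]
    · simp
    · grind

theorem B_mul (m : ℕ) (hm : Even m) (u : ℕ → ℚ) :
    (qm (levelt (m+1) cQalt)).mulVec (fun k => u k) = fun i : Fin (m+1) =>
      (if (i:ℕ) = 0 then 0 else u ((i:ℕ) - 1)) + (-1) ^ (i:ℕ) * u m := by
  ext i
  rw [lev_mul, cQ_eq m hm i (by omega)]
  ring

theorem Av (m : ℕ) (hm : Even m) (hm4 : 4 ≤ m) :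
    (qm (levelt (m+1) (cP10 (m+1)))).mulVec (fun k : Fin (m+1) => vc m k) =
      - (qm (levelt (m+1) cQalt)).mulVec (fun k : Fin (m+1) => vc m k) := by
  rw [B_mul m hm]
  ext i
  have hi := i.2
  rw [lev_mul]
  simp only [Pi.neg_apply]
  rcases Nat.eq_zero_or_pos (i:ℕ) with h | h
  · simp [h, vc, cP10]
  · obtain ⟨j, hj⟩ : ∃ j, (i:ℕ) = j + 1 := ⟨(i:ℕ) - 1, by omega⟩
    have h1 : j ≠ m := by omega
    simp [hj, vc, cP10, h1, pow_succ]
    split_ifs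
    · omega
    · push_cast; ring

theorem orth (m : ℕ) (hm : Even m) (hm4 : 4 ≤ m)
    (f : Matrix (Fin (m+1)) (Fin (m+1)) ℚ)
    (hfA : (qm (levelt (m+1) (cP10 (m+1))))ᵀ * f * qm (levelt (m+1) (cP10 (m+1))) = f)
    (hfB : (qm (levelt (m+1) cQalt))ᵀ * f * qm (levelt (m+1) cQalt) = f)
    (u : ℕ → ℚ) (hu : u m = 0) :
    (fun k : Fin (m+1) => vc m k) ⬝ᵥ f.mulVec (fun k : Fin (m+1) => u k) = 0 := by
  have h1 := inv_form _ f hfA (fun k : Fin (m+1) => vc m k) (fun k : Fin (m+1) => u k)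
  have h2 := inv_form _ f hfB (fun k : Fin (m+1) => vc m k) (fun k : Fin (m+1) => u k)
  have h3 : (qm (levelt (m+1) (cP10 (m+1)))).mulVec (fun k : Fin (m+1) => u k) =
      (qm (levelt (m+1) cQalt)).mulVec (fun k : Fin (m+1) => u k) := by
    ext i
    rw [lev_mul, lev_mul, hu]
    simp
  rw [Av m hm hm4, h3, neg_dotProduct] at h1
  linarith

theorem form_v (m : ℕ) (hm : Even m) (hm4 : 4 ≤ m)
    (f : Matrix (Fin (m+1)) (Fin (m+1)) ℚ)
    (hfA : (qm (levelt (m+1) (cP10 (m+1))))ᵀ * f * qm (levelt (m+1) (cP10 (m+1))) = f)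
    (hfB : (qm (levelt (m+1) cQalt))ᵀ * f * qm (levelt (m+1) cQalt) = f)
    (hv : (fun k : Fin (m+1) => vc m k) ⬝ᵥ f.mulVec (fun k : Fin (m+1) => vc m k) = -2)
    (u : ℕ → ℚ) :
    (fun k : Fin (m+1) => vc m k) ⬝ᵥ f.mulVec (fun k : Fin (m+1) => u k) = - u m := by
  have h := orth m hm hm4 f hfA hfB (fun k => u k - (u m / 2) * vc m k) (by simp [vc])
  have e : (fun k : Fin (m+1) => u k - (u m / 2) * vc m k) =
      (fun k : Fin (m+1) => u k) - (u m / 2) • (fun k : Fin (m+1) => vc m k) := by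
    ext k; simp
  rw [e, Matrix.mulVec_sub, Matrix.mulVec_smul, dotProduct_sub, dotProduct_smul, hv] at h
  simp only [smul_eq_mul] at h
  linarith

/-- explicit coordinates of `B v` -/
def w1 : ℕ → ℚ := fun i => if i = 0 then 2 else 2 + (-1) ^ i

/-- explicit coordinates of `B ^ k v`, `k ≥ 2` -/
def wk (k : ℕ) : ℕ → ℚ := fun i =>
  2 + 2 * (-1) ^ i - (if i + 2 = k then 1 else 0) - (if i + 1 = k then 1 else 0)

theorem Bv1 (m : ℕ) (hm : Even m) (hm4 : 4 ≤ m) :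
    (qm (levelt (m+1) cQalt)).mulVec (fun k : Fin (m+1) => vc m k) =
      fun k : Fin (m+1) => w1 k := by
  rw [B_mul m hm]
  ext i
  have hi := i.2
  rcases Nat.eq_zero_or_pos (i:ℕ) with h | h
  · simp [h, vc, w1]
  · obtain ⟨j, hj⟩ : ∃ j, (i:ℕ) = j + 1 := ⟨(i:ℕ) - 1, by omega⟩
    have h1 : j ≠ m := by omega
    simp [hj, vc, w1, h1, pow_succ]
    ring

theorem Bv2 (m : ℕ) (hm : Even m) (hm4 : 4 ≤ m) :
    (qm (levelt (m+1) cQalt)).mulVec (fun k : Fin (m+1) => w1 k) =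
      fun k : Fin (m+1) => wk 2 k := by
  rw [B_mul m hm]
  ext i
  have hi := i.2
  have h0 : m ≠ 0 := by omega
  rcases Nat.eq_zero_or_pos (i:ℕ) with h | h
  · simp [h, wk, w1, h0, hm.neg_one_pow]
    norm_num
  · obtain ⟨j, hj⟩ : ∃ j, (i:ℕ) = j + 1 := ⟨(i:ℕ) - 1, by omega⟩
    rcases Nat.eq_zero_or_pos j with h' | h'
    · simp [hj, h', wk, w1, h0, hm.neg_one_pow]
      try norm_num
    · have h1 : j ≠ 0 := by omega
      simp [hj, wk, w1, h0, h1, hm.neg_one_pow, pow_succ]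
      try ring

theorem Bvk (m : ℕ) (hm : Even m) (hm4 : 4 ≤ m) (k : ℕ) (hk : 2 ≤ k) (hkm : k ≤ m) :
    (qm (levelt (m+1) cQalt)).mulVec (fun i : Fin (m+1) => wk k i) =
      fun i : Fin (m+1) => wk (k+1) i := by
  rw [B_mul m hm]
  ext i
  have hi := i.2
  have e1 : m + 2 ≠ k := by omega
  have e2 : m + 1 ≠ k := by omega
  rcases Nat.eq_zero_or_pos (i:ℕ) with h | h
  · have e3 : 2 ≠ k + 1 := by omega
    have e4 : k ≠ 0 := by omega
    simp [h, wk, e1, e2, e3, e4, hm.neg_one_pow]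
  · obtain ⟨j, hj⟩ : ∃ j, (i:ℕ) = j + 1 := ⟨(i:ℕ) - 1, by omega⟩
    have e5 : (j + 1 + 2 = k + 1) ↔ (j + 2 = k) := by omega
    have e6 : (j + 1 + 1 = k + 1) ↔ (j + 1 = k) := by omega
    simp only [hj, wk, e1, e2, e5, e6, hm.neg_one_pow, pow_succ, Nat.add_sub_cancel,
      Nat.succ_ne_zero, if_false]
    ring

theorem Bpow (m : ℕ) (hm : Even m) (hm4 : 4 ≤ m) (k : ℕ) (hkm : k + 2 ≤ m) :
    (qm (levelt (m+1) cQalt) ^ (k+2)).mulVec (fun i : Fin (m+1) => vc m i) =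
      fun i : Fin (m+1) => wk (k+2) i := by
  induction k with
  | zero =>
    rw [zero_add, pow_two, ← Matrix.mulVec_mulVec, Bv1 m hm hm4, Bv2 m hm hm4]
  | succ k ih =>
    rw [show k + 1 + 2 = (k + 2) + 1 by ring, pow_succ', ← Matrix.mulVec_mulVec,
      ih (by omega), Bvk m hm hm4 (k+2) (by omega) (by omega)]

theorem form_k (m : ℕ) (hm : Even m) (hm4 : 4 ≤ m)
    (f : Matrix (Fin (m+1)) (Fin (m+1)) ℚ)
    (hfA : (qm (levelt (m+1) (cP10 (m+1))))ᵀ * f * qm (levelt (m+1) (cP10 (m+1))) = f)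
    (hfB : (qm (levelt (m+1) cQalt))ᵀ * f * qm (levelt (m+1) cQalt) = f)
    (hv : (fun k : Fin (m+1) => vc m k) ⬝ᵥ f.mulVec (fun k : Fin (m+1) => vc m k) = -2)
    (k : ℕ) (hk : k ≤ m) :
    (fun k : Fin (m+1) => vc m k) ⬝ᵥ f.mulVec
      ((qm (levelt (m+1) cQalt) ^ k).mulVec (fun i : Fin (m+1) => vc m i)) =
      if k = 0 then -2 else if k = 1 then -3 else -4 := by
  match k, hk with
  | 0, _ => simpa using hv
  | 1, _ =>
    rw [pow_one, Bv1 m hm hm4, form_v m hm hm4 f hfA hfB hv]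
    have h0 : m ≠ 0 := by omega
    simp [w1, h0, hm.neg_one_pow]
    norm_num
  | k+2, hk =>
    rw [Bpow m hm hm4 k hk, form_v m hm hm4 f hfA hfB hv]
    have e : m ≠ k := by omega
    have e2 : m ≠ k + 1 := by omega
    simp [wk, e, e2, hm.neg_one_pow]
    norm_num

theorem form_ij (m : ℕ) (hm : Even m) (hm4 : 4 ≤ m)
    (f : Matrix (Fin (m+1)) (Fin (m+1)) ℚ)
    (hfA : (qm (levelt (m+1) (cP10 (m+1))))ᵀ * f * qm (levelt (m+1) (cP10 (m+1))) = f)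
    (hfB : (qm (levelt (m+1) cQalt))ᵀ * f * qm (levelt (m+1) cQalt) = f)
    (hv : (fun k : Fin (m+1) => vc m k) ⬝ᵥ f.mulVec (fun k : Fin (m+1) => vc m k) = -2)
    (i k : ℕ) (hk : k ≤ m) :
    ((qm (levelt (m+1) cQalt) ^ i).mulVec (fun k : Fin (m+1) => vc m k)) ⬝ᵥ f.mulVec
      ((qm (levelt (m+1) cQalt) ^ (i + k)).mulVec (fun i : Fin (m+1) => vc m i)) =
      if k = 0 then -2 else if k = 1 then -3 else -4 := by
  rw [pow_add, ← Matrix.mulVec_mulVec, inv_form_pow _ f hfB, form_k m hm hm4 f hfA hfB hv k hk]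

theorem form_symm {n : ℕ} (f : Matrix (Fin n) (Fin n) ℚ) (h : f.IsSymm) (x y : Fin n → ℚ) :
    x ⬝ᵥ f.mulVec y = y ⬝ᵥ f.mulVec x := by
  rw [Matrix.dotProduct_mulVec, dotProduct_comm, ← Matrix.mulVec_transpose, h.eq]

theorem stmt10 (n : ℕ) (hn : 5 ≤ n) (hodd : Odd n)
    (f : Matrix (Fin n) (Fin n) ℚ) (hsymm : f.IsSymm)
    (hfA : (qm (levelt n (cP10 n)))ᵀ * f * qm (levelt n (cP10 n)) = f)
    (hfB : (qm (levelt n cQalt))ᵀ * f * qm (levelt n cQalt) = f)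
    (hv : qv (vvec n (cP10 n) cQalt) ⬝ᵥ f.mulVec (qv (vvec n (cP10 n) cQalt)) = -2) :
    ∀ i j : ℕ, i ≤ n - 1 → j ≤ n - 1 →
      ((i = j →
        ((qm (levelt n cQalt) ^ i).mulVec (qv (vvec n (cP10 n) cQalt))) ⬝ᵥ
          f.mulVec ((qm (levelt n cQalt) ^ j).mulVec (qv (vvec n (cP10 n) cQalt))) = -2) ∧
      (((i : ℤ) - (j : ℤ)).natAbs = 1 →
        ((qm (levelt n cQalt) ^ i).mulVec (qv (vvec n (cP10 n) cQalt))) ⬝ᵥ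
          f.mulVec ((qm (levelt n cQalt) ^ j).mulVec (qv (vvec n (cP10 n) cQalt))) = -3) ∧
      (2 ≤ ((i : ℤ) - (j : ℤ)).natAbs →
        ((qm (levelt n cQalt) ^ i).mulVec (qv (vvec n (cP10 n) cQalt))) ⬝ᵥ
          f.mulVec ((qm (levelt n cQalt) ^ j).mulVec (qv (vvec n (cP10 n) cQalt))) = -4)) := by
  obtain ⟨m, rfl⟩ : ∃ m, n = m + 1 := ⟨n - 1, by omega⟩
  have hm : Even m := by grind
  have hm4 : 4 ≤ m := by omega
  rw [v_eq m hm] at hv ⊢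
  intro i j hi hj
  have key : ((qm (levelt (m+1) cQalt) ^ i).mulVec (fun k : Fin (m+1) => vc m k)) ⬝ᵥ f.mulVec
      ((qm (levelt (m+1) cQalt) ^ j).mulVec (fun i : Fin (m+1) => vc m i)) =
      if ((i : ℤ) - (j : ℤ)).natAbs = 0 then -2 else
        if ((i : ℤ) - (j : ℤ)).natAbs = 1 then -3 else -4 := by
    rcases le_total i j with h | h
    · obtain ⟨k, rfl⟩ := Nat.exists_eq_add_of_le h
      rw [form_ij m hm hm4 f hfA hfB hv i k (by omega)]
      have : ((i : ℤ) - ((i + k : ℕ) : ℤ)).natAbs = k := by omega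
      rw [this]
    · obtain ⟨k, rfl⟩ := Nat.exists_eq_add_of_le h
      rw [form_symm f hsymm, form_ij m hm hm4 f hfA hfB hv j k (by omega)]
      have : (((j + k : ℕ) : ℤ) - (j : ℤ)).natAbs = k := by omega
      rw [this]
  rw [key]
  refine ⟨fun h => ?_, fun h => ?_, fun h => ?_⟩
  · rw [if_pos (by omega)]
  · rw [if_neg (by omega), if_pos h]
  · rw [if_neg (by omega), if_neg (by omega)]
end

section
/- Let n ≥ 7 with n ≡ 1 or 3 (mod 6). Let F be the symmetric n×n integer matrix (indices 1, …, n) with F_{ij} = −2 if i = j; −4 if |i−j| = 1; −8 if |i−j| = 2 or |i−j| = n−1; −11 if |i−j| = 3 or |i−j| = n−2; and −12 otherwise. Set m := n−3 if n ≡ 1 (mod 6) and m := n−5 if n ≡ 3 (mod 6). Define u ∈ ℤⁿ by: uᵢ = 1 if i ≡ 1 (mod 6) and i ≤ m; uᵢ = −2 if i ≡ 2 (mod 6) and i ≤ m; uᵢ = 2 if i ≡ 3 (mod 6) and i ≤ m; uᵢ = −1 if i ≡ 4 (mod 6) and i ≤ m; and uᵢ = 0 otherwise. Then uᵗFu = 2.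 -/
open Matrix

/-- The Gram matrix of the normalized quadratic form of the family `𝒩₁(3,n,n)` in the
basis `v, Bv, …, B^{n-1}v`: the entry at `(i,j)` depends on `d = |i-j|` as
`-2, -4, -8 (d = 2 or n-1), -11 (d = 3 or n-2), -12` otherwise. -/
def F12 (n : ℕ) : Matrix (Fin n) (Fin n) ℤ :=
  Matrix.of fun i j =>
    if (i : ℕ) = (j : ℕ) then -2
    else if (((i : ℕ) : ℤ) - ((j : ℕ) : ℤ)).natAbs = 1 then -4
    else if (((i : ℕ) : ℤ) - ((j : ℕ) : ℤ)).natAbs = 2 ∨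
      (((i : ℕ) : ℤ) - ((j : ℕ) : ℤ)).natAbs = n - 1 then -8
    else if (((i : ℕ) : ℤ) - ((j : ℕ) : ℤ)).natAbs = 3 ∨
      (((i : ℕ) : ℤ) - ((j : ℕ) : ℤ)).natAbs = n - 2 then -11
    else -12

/-- The vector `u` of Lemma 4.8: with `1`-indexed coordinates, `uᵢ = 1, -2, 2, -1` according
as `i ≡ 1, 2, 3, 4 (mod 6)` when `i ≤ m`, and `uᵢ = 0` otherwise. -/
def u12 (n m : ℕ) : Fin n → ℤ := fun i =>
  if (i : ℕ) + 1 ≤ m then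
    if ((i : ℕ) + 1) % 6 = 1 then 1
    else if ((i : ℕ) + 1) % 6 = 2 then -2
    else if ((i : ℕ) + 1) % 6 = 3 then 2
    else if ((i : ℕ) + 1) % 6 = 4 then -1
    else 0
  else 0

def w12 (i : ℕ) : ℤ :=
  if (i + 1) % 6 = 1 then 1
    else if (i + 1) % 6 = 2 then -2
    else if (i + 1) % 6 = 3 then 2
    else if (i + 1) % 6 = 4 then -1
    else 0

def g12 (i j : ℕ) : ℤ :=
  if i = j then 10
  else if ((i : ℤ) - (j : ℤ)).natAbs = 1 then 8
  else if ((i : ℤ) - (j : ℤ)).natAbs = 2 then 4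
  else if ((i : ℤ) - (j : ℤ)).natAbs = 3 then 1
  else 0

def Q12 (N : ℕ) : ℤ := ∑ i ∈ Finset.range N, ∑ j ∈ Finset.range N, w12 i * g12 i j * w12 j

lemma g12_symm (i j : ℕ) : g12 i j = g12 j i := by
  unfold g12
  have : ((i : ℤ) - (j : ℤ)).natAbs = ((j : ℤ) - (i : ℤ)).natAbs := by omega
  rw [this]
  simp only [eq_comm (a := i) (b := j)]

lemma g12_self (i : ℕ) : g12 i i = 10 := by simp [g12]

lemma row12 (M : ℕ) : ∑ j ∈ Finset.range (M + 3), w12 (M+3) * g12 (M+3) j * w12 j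
    = w12 (M+3) * (w12 M + 4 * w12 (M+1) + 8 * w12 (M+2)) := by
  rw [Finset.sum_range_succ, Finset.sum_range_succ, Finset.sum_range_succ, Finset.sum_eq_zero]
  · have h0 : g12 (M+3) M = 1 := by unfold g12; split_ifs <;> omega
    have h1 : g12 (M+3) (M+1) = 4 := by unfold g12; split_ifs <;> omega
    have h2 : g12 (M+3) (M+2) = 8 := by unfold g12; split_ifs <;> omega
    rw [h0, h1, h2]; ring
  · intro j hj
    rw [Finset.mem_range] at hj
    have : g12 (M+3) j = 0 := by unfold g12; split_ifs <;> omega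
    rw [this]; ring

lemma Q12_succ (M : ℕ) : Q12 (M+4) = Q12 (M+3)
    + 2 * (w12 (M+3) * (w12 M + 4 * w12 (M+1) + 8 * w12 (M+2))) + 10 * w12 (M+3) ^ 2 := by
  have h2 : ∑ i ∈ Finset.range (M + 3), w12 i * g12 i (M+3) * w12 (M+3)
    = w12 (M+3) * (w12 M + 4 * w12 (M+1) + 8 * w12 (M+2)) := by
    rw [← row12]
    refine Finset.sum_congr rfl fun j _ => ?_
    rw [g12_symm j]; ring
  unfold Q12
  rw [show M + 4 = (M + 3) + 1 from rfl, Finset.sum_range_succ]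
  simp_rw [Finset.sum_range_succ _ (M+3)]
  rw [Finset.sum_add_distrib, h2, row12, g12_self]
  ring

lemma w12_vals (k : ℕ) : w12 (6*k) = 1 ∧ w12 (6*k+1) = -2 ∧ w12 (6*k+2) = 2 ∧ w12 (6*k+3) = -1
    ∧ w12 (6*k+4) = 0 ∧ w12 (6*k+5) = 0 := by
  unfold w12
  refine ⟨?_, ?_, ?_, ?_, ?_, ?_⟩ <;> (split_ifs <;> omega)

lemma Q12_eq (k : ℕ) : Q12 (6*k+4) = 2 := by
  induction k with
  | zero => decide
  | succ k ih =>
    obtain ⟨a0, a1, a2, a3, a4, a5⟩ := w12_vals k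
    obtain ⟨b0, b1, b2, b3, -, -⟩ := w12_vals (k+1)
    rw [show 6*(k+1) = 6*k+6 by ring] at *
    simp only [add_assoc, Nat.reduceAdd] at *
    have e5 := Q12_succ (6*k+1)
    have e6 := Q12_succ (6*k+2)
    have e7 := Q12_succ (6*k+3)
    have e8 := Q12_succ (6*k+4)
    have e9 := Q12_succ (6*k+5)
    have e10 := Q12_succ (6*k+6)
    simp only [add_assoc, Nat.reduceAdd, a0, a1, a2, a3, a4, a5, b0, b1, b2, b3] at *
    linarith

lemma sw12 (k : ℕ) : ∑ i ∈ Finset.range (6*k+4), w12 i = 0 := by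
  induction k with
  | zero => decide
  | succ k ih =>
    obtain ⟨a0, a1, a2, a3, a4, a5⟩ := w12_vals k
    obtain ⟨b0, b1, b2, b3, -, -⟩ := w12_vals (k+1)
    rw [show 6*(k+1) = 6*k+6 by ring] at *
    simp only [add_assoc, Nat.reduceAdd] at *
    rw [Finset.sum_range_succ, Finset.sum_range_succ, Finset.sum_range_succ,
      Finset.sum_range_succ, Finset.sum_range_succ, Finset.sum_range_succ,
      ih, a4, a5, b0, b1, b2, b3]
    norm_num

lemma main12 (n k : ℕ) (h : 6*k+4+3 ≤ n) :
    u12 n (6*k+4) ⬝ᵥ (F12 n).mulVec (u12 n (6*k+4)) = 2 := by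
  have key : ∀ i j : Fin n, u12 n (6*k+4) i * (F12 n i j * u12 n (6*k+4) j)
      = (fun i j : ℕ => if i < 6*k+4 then if j < 6*k+4 then
          w12 i * g12 i j * w12 j - 12 * (w12 i * w12 j) else 0 else 0) i j := by
    intro i j
    by_cases hi : (i : ℕ) < 6*k+4
    · by_cases hj : (j : ℕ) < 6*k+4
      · have e1 : u12 n (6*k+4) i = w12 i := by
          unfold u12 w12; rw [if_pos (by omega)]
        have e2 : u12 n (6*k+4) j = w12 j := by
          unfold u12 w12; rw [if_pos (by omega)]
        have e3 : F12 n i j = g12 i j - 12 := by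
          unfold F12 g12
          simp only [Matrix.of_apply]
          split_ifs <;> omega
        simp only [hi, hj, if_true, e1, e2, e3]; ring
      · have e2 : u12 n (6*k+4) j = 0 := by
          unfold u12; rw [if_neg (by omega)]
        simp [hj, e2]
    · have e2 : u12 n (6*k+4) i = 0 := by
        unfold u12; rw [if_neg (by omega)]
      simp [hi, e2]
  have filt : ∀ f : ℕ → ℤ, ∑ i ∈ Finset.range n, (if i < 6*k+4 then f i else 0)
      = ∑ i ∈ Finset.range (6*k+4), f i := by
    intro f
    rw [← Finset.sum_filter]
    refine Finset.sum_congr ?_ fun _ _ => rfl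
    ext i; simp only [Finset.mem_filter, Finset.mem_range]; omega
  simp only [dotProduct, Matrix.mulVec, Finset.mul_sum]
  simp_rw [key]
  have step : ∀ G : ℕ → ℕ → ℤ, ∑ i : Fin n, ∑ j : Fin n, G i j
      = ∑ i ∈ Finset.range n, ∑ j ∈ Finset.range n, G i j := by
    intro G
    rw [Finset.sum_range]
    refine Finset.sum_congr rfl fun i _ => ?_
    rw [Finset.sum_range]
  refine (step (fun i j : ℕ => if i < 6*k+4 then if j < 6*k+4 then
          w12 i * g12 i j * w12 j - 12 * (w12 i * w12 j) else 0 else 0)).trans ?_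
  have e : ∀ i, ∑ j ∈ Finset.range n, (if i < 6*k+4 then if j < 6*k+4 then
          w12 i * g12 i j * w12 j - 12 * (w12 i * w12 j) else 0 else 0)
      = if i < 6*k+4 then ∑ j ∈ Finset.range (6*k+4),
          (w12 i * g12 i j * w12 j - 12 * (w12 i * w12 j)) else 0 := by
    intro i
    split_ifs
    · exact filt _
    · simp
  simp_rw [e]
  rw [filt]
  simp_rw [Finset.sum_sub_distrib, ← Finset.mul_sum, sw12]
  have := Q12_eq k
  unfold Q12 at this
  simpa using this

theorem stmt12 (n : ℕ) (hn : 7 ≤ n) (hmod : n % 6 = 1 ∨ n % 6 = 3) :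
    u12 n (if n % 6 = 1 then n - 3 else n - 5) ⬝ᵥ
      (F12 n).mulVec (u12 n (if n % 6 = 1 then n - 3 else n - 5)) = 2 := by
  obtain ⟨k, hk, hk2⟩ : ∃ k, (if n % 6 = 1 then n - 3 else n - 5) = 6*k+4 ∧ 6*k+4+3 ≤ n := by
    refine ⟨(n-7)/6, ?_, ?_⟩
    · split_ifs <;> omega
    · omega
  rw [hk]
  exact main12 n k hk2
end

section
/- Let n ≥ 7 with n ≡ 1 (mod 6). Let F be the symmetric n×n integer matrix (indices 1, …, n) with F_{ij} = −2 if i = j; −4 if |i−j| = 1; −8 if |i−j| = 2 or |i−j| = n−1; −11 if |i−j| = 3 or |i−j| = n−2; and −12 otherwise. Set m := n−3 and define u ∈ ℤⁿ by uᵢ = 1, −2, 2, −1 according as i ≡ 1, 2, 3, 4 (mod 6) for i ≤ m, and uᵢ = 0 otherwise. Let w := u + e_{n−1}, where e_{n−1} is the (n−1)-st standard basis vector. Then wᵗFw = −2, wᵗF e_{n−1} = −3, and wᵗF e_n = −3. -/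
open Matrix

open Matrix Finset in
lemma aux_block (φ : ℕ → ℤ) (U : ℕ → ℤ) (K : ℕ)
    (hU : ∀ b < K, U (6*b) = 1 ∧ U (6*b+1) = -2 ∧ U (6*b+2) = 2 ∧ U (6*b+3) = -1 ∧
      U (6*b+4) = 0 ∧ U (6*b+5) = 0) :
    ∑ j ∈ range (6*K), φ j * U j =
      ∑ b ∈ range K, (φ (6*b) - 2 * φ (6*b+1) + 2 * φ (6*b+2) - φ (6*b+3)) := by
  induction K with
  | zero => simp
  | succ K ih =>
    rw [sum_range_succ, ← ih (fun b hb => hU b (by omega)), show 6*(K+1) = 6*K+1+1+1+1+1+1 by ring]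
    simp only [sum_range_succ]
    obtain ⟨h0, h1, h2, h3, h4, h5⟩ := hU K (by omega)
    rw [h0, h1, h2, h3, h4, h5]
    ring

def auxf (n : ℕ) (i j : ℕ) : ℤ :=
    if i = j then -2
    else if ((i : ℤ) - (j : ℤ)).natAbs = 1 then -4
    else if ((i : ℤ) - (j : ℤ)).natAbs = 2 ∨
      ((i : ℤ) - (j : ℤ)).natAbs = n - 1 then -8
    else if ((i : ℤ) - (j : ℤ)).natAbs = 3 ∨
      ((i : ℤ) - (j : ℤ)).natAbs = n - 2 then -11
    else -12

def auxu (m : ℕ) (i : ℕ) : ℤ :=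
  if i + 1 ≤ m then
    if (i + 1) % 6 = 1 then 1
    else if (i + 1) % 6 = 2 then -2
    else if (i + 1) % 6 = 3 then 2
    else if (i + 1) % 6 = 4 then -1
    else 0
  else 0

/-- Telescoping kernel. -/
def auxp (i K : ℕ) : ℤ :=
  if i = K then 1 else if i + 1 = K then 2 else if i + 2 = K then 2 else if i + 3 = K then 1 else 0

def auxg (k i K : ℕ) : ℤ :=
  (if i = 0 then 1 else 0) - auxp i K +
    (if i = 6*k+6 then 2 else if i = 6*k+5 then 1 else 0)

lemma auxf_near (k i j : ℕ) (hi : i < 6*k+7) (hj : 2 ≤ j) (hj' : j ≤ 6*k+3) :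
    auxf (6*k+7) i j = if i = j then -2 else if i + 1 = j ∨ j + 1 = i then -4
      else if i + 2 = j ∨ j + 2 = i then -8 else if i + 3 = j ∨ j + 3 = i then -11 else -12 := by
  unfold auxf
  split_ifs <;> first | rfl | (exfalso; omega)

lemma auxf_zero (k i : ℕ) (hi : i < 6*k+7) :
    auxf (6*k+7) i 0 = if i = 0 then -2 else if i = 1 then -4
      else if i = 2 ∨ i = 6*k+6 then -8 else if i = 3 ∨ i = 6*k+5 then -11 else -12 := by
  unfold auxf
  split_ifs <;> first | rfl | (exfalso; omega)

lemma auxf_one (k i : ℕ) (hi : i < 6*k+7) :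
    auxf (6*k+7) i 1 = if i = 1 then -2 else if i = 0 ∨ i = 2 then -4
      else if i = 3 then -8 else if i = 4 ∨ i = 6*k+6 then -11 else -12 := by
  unfold auxf
  split_ifs <;> first | rfl | (exfalso; omega)

lemma aux_base_small (k i : ℕ) (hi : i < 6*k+7) (h : i < 7) :
    auxf (6*k+7) i (6*0) - 2 * auxf (6*k+7) i (6*0+1)
      + 2 * auxf (6*k+7) i (6*0+2) - auxf (6*k+7) i (6*0+3) = auxg k i (6*0+6) := by
  rw [auxf_zero k i hi, auxf_one k i hi, auxf_near k i _ hi (by omega) (by omega),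
      auxf_near k i _ hi (by omega) (by omega)]
  unfold auxg auxp
  rcases Nat.eq_zero_or_pos k with h' | h'
  · subst h'
    interval_cases i <;> simp
  · have h5 : i ≠ 6*k+5 := by omega
    have h6 : i ≠ 6*k+6 := by omega
    simp only [h5, h6, if_false, or_false]
    clear h5 h6 hi
    interval_cases i <;> simp

lemma aux_base (k i : ℕ) (hi : i < 6*k+7) :
    auxf (6*k+7) i (6*0) - 2 * auxf (6*k+7) i (6*0+1)
      + 2 * auxf (6*k+7) i (6*0+2) - auxf (6*k+7) i (6*0+3) = auxg k i (6*0+6) := by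
  rcases Nat.lt_or_ge i 7 with h | h
  · exact aux_base_small k i hi h
  have e : auxp i (6*0+6) = 0 := by
    unfold auxp; split_ifs <;> first | rfl | (exfalso; omega)
  have e2 : auxf (6*k+7) i (6*0+2) = -12 := by
    rw [auxf_near k i _ hi (by omega) (by omega)]
    split_ifs <;> first | rfl | (exfalso; omega)
  have e3 : auxf (6*k+7) i (6*0+3) = -12 := by
    rw [auxf_near k i _ hi (by omega) (by omega)]
    split_ifs <;> first | rfl | (exfalso; omega)
  rw [e2, e3, auxf_zero k i hi, auxf_one k i hi]
  unfold auxg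
  rw [e]
  split_ifs <;> first | rfl | (exfalso; omega)

/-- Local value of the form away from the wrap-around. -/
def auxc (i j : ℕ) : ℤ :=
  if i = j then -2 else if i + 1 = j ∨ j + 1 = i then -4
      else if i + 2 = j ∨ j + 2 = i then -8 else if i + 3 = j ∨ j + 3 = i then -11 else -12

lemma auxc_far (i j : ℕ) (h : i + 3 < j ∨ j + 3 < i) : auxc i j = -12 := by
  unfold auxc
  split_ifs <;> first | rfl | (exfalso; omega)

lemma auxp_far (i j : ℕ) (h : i + 3 < j ∨ j < i) : auxp i j = 0 := by
  unfold auxp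
  split_ifs <;> first | rfl | (exfalso; omega)

lemma aux_step (i N : ℕ) : auxc i (N+3) - 2 * auxc i (N+4) + 2 * auxc i (N+5) - auxc i (N+6) =
    auxp i (N+3) - auxp i (N+9) := by
  by_cases h1 : i < N
  · rw [auxc_far _ _ (by omega), auxc_far _ _ (by omega), auxc_far _ _ (by omega),
      auxc_far _ _ (by omega), auxp_far _ _ (by omega), auxp_far _ _ (by omega)]; rfl
  by_cases h2 : N + 9 < i
  · rw [auxc_far _ _ (by omega), auxc_far _ _ (by omega), auxc_far _ _ (by omega),
      auxc_far _ _ (by omega), auxp_far _ _ (by omega), auxp_far _ _ (by omega)]; rfl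
  obtain ⟨d, rfl⟩ : ∃ d, i = N + d := ⟨i - N, by omega⟩
  have hd : d < 10 := by omega
  clear h1 h2
  unfold auxc auxp
  simp only [Nat.add_assoc, Nat.add_left_cancel_iff]
  interval_cases d <;> simp

open Finset in
lemma aux_tel (k i : ℕ) (hi : i < 6*k+7) (K : ℕ) (hK : K ≤ k) :
    ∑ b ∈ range (K+1), (auxf (6*k+7) i (6*b) - 2 * auxf (6*k+7) i (6*b+1)
      + 2 * auxf (6*k+7) i (6*b+2) - auxf (6*k+7) i (6*b+3)) = auxg k i (6*K+6) := by
  induction K with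
  | zero =>
    rw [sum_range_one]; exact aux_base k i hi
  | succ K ih =>
    rw [sum_range_succ, ih (by omega)]
    rw [auxf_near k i _ hi (by omega) (by omega), auxf_near k i _ hi (by omega) (by omega),
      auxf_near k i _ hi (by omega) (by omega), auxf_near k i _ hi (by omega) (by omega)]
    unfold auxg
    have h := aux_step i (6*K+3)
    unfold auxc at h
    rw [show 6*(K+1) = 6*K+3+3 by ring]
    linarith

open Finset in
lemma aux_Fu (k i : ℕ) (hi : i < 6*k+7) :
    ∑ j ∈ range (6*k+7), auxf (6*k+7) i j * auxu (6*k+4) j = auxg k i (6*k+6) := by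
  rw [show 6*k+7 = 6*(k+1)+1 by ring, sum_range_succ, aux_block]
  · rw [show 6*(k+1)+1 = 6*k+7 by ring, aux_tel k i hi k le_rfl]
    simp [auxu]; intros; omega
  · intro b hb
    unfold auxu
    refine ⟨?_, ?_, ?_, ?_, ?_, ?_⟩ <;> (split_ifs <;> first | rfl | (exfalso; omega))

open Finset in
lemma aux_uFu (k : ℕ) :
    ∑ i ∈ range (6*k+7), auxu (6*k+4) i * auxg k i (6*k+6) = 2 := by
  have : ∀ i ∈ range (6*k+7), auxu (6*k+4) i * auxg k i (6*k+6) =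
      (if i = 0 then 1 else 0) + (if i = 6*k+3 then 1 else 0) := by
    intro i hi
    have hi := mem_range.1 hi
    by_cases h0 : i = 0
    · subst h0; simp [auxu, auxg, auxp]
    by_cases h3 : i = 6*k+3
    · subst h3
      have : auxu (6*k+4) (6*k+3) = -1 := by
        unfold auxu; split_ifs <;> first | rfl | (exfalso; omega)
      rw [this]; simp [auxg, auxp]
    by_cases h4 : i < 6*k+3
    · have : auxg k i (6*k+6) = 0 := by
        unfold auxg auxp; split_ifs <;> first | rfl | (exfalso; omega)
      simp [this, h0, h3]
    · have : auxu (6*k+4) i = 0 := by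
        unfold auxu; rw [if_neg (by omega)]
      simp [this, h0, h3]
  rw [sum_congr rfl this, sum_add_distrib]
  simp

lemma aux_symm (n : ℕ) : (F12 n)ᵀ = F12 n := by
  ext i j
  simp only [F12, transpose_apply, of_apply]
  split_ifs <;> first | rfl | (exfalso; omega)

lemma aux_mulVec (k : ℕ) (i : Fin (6*k+7)) :
    (F12 (6*k+7)).mulVec (u12 (6*k+7) (6*k+4)) i = auxg k i (6*k+6) := by
  rw [← aux_Fu k i i.2, ← Fin.sum_univ_eq_sum_range (fun j => auxf (6*k+7) i j * auxu (6*k+4) j)]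
  rfl

lemma aux_main (n : ℕ) (F : Matrix (Fin n) (Fin n) ℤ) (hF : Fᵀ = F) (u : Fin n → ℤ) (a b : Fin n) :
    (u + Pi.single a 1) ⬝ᵥ F.mulVec (u + Pi.single a 1) =
      u ⬝ᵥ F.mulVec u + 2 * F.mulVec u a + F a a ∧
    (u + Pi.single a 1) ⬝ᵥ F.mulVec (Pi.single b 1) = F.mulVec u b + F a b := by
  have h : ∀ b, u ⬝ᵥ F.mulVec (Pi.single b 1) = F.mulVec u b := by
    intro b
    rw [dotProduct_mulVec, ← mulVec_transpose, hF]; simp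
  constructor
  · rw [mulVec_add, dotProduct_add, add_dotProduct, add_dotProduct, h]
    simp; ring
  · rw [add_dotProduct, h]; simp

theorem stmt13 (n : ℕ) (hn : 7 ≤ n) (hmod : n % 6 = 1) :
    (u12 n (n - 3) + Pi.single (⟨n - 2, by omega⟩ : Fin n) 1) ⬝ᵥ
        (F12 n).mulVec (u12 n (n - 3) + Pi.single (⟨n - 2, by omega⟩ : Fin n) 1) = -2 ∧
    (u12 n (n - 3) + Pi.single (⟨n - 2, by omega⟩ : Fin n) 1) ⬝ᵥ
        (F12 n).mulVec (Pi.single (⟨n - 2, by omega⟩ : Fin n) 1) = -3 ∧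
    (u12 n (n - 3) + Pi.single (⟨n - 2, by omega⟩ : Fin n) 1) ⬝ᵥ
        (F12 n).mulVec (Pi.single (⟨n - 1, by omega⟩ : Fin n) 1) = -3 := by
  obtain ⟨k, rfl⟩ : ∃ k, n = 6*k+7 := ⟨(n-7)/6, by omega⟩
  have hs := aux_symm (6*k+7)
  have hu : u12 (6*k+7) (6*k+7-3) ⬝ᵥ (F12 (6*k+7)).mulVec (u12 (6*k+7) (6*k+7-3)) = 2 := by
    rw [← aux_uFu k, ← Fin.sum_univ_eq_sum_range (fun i => auxu (6*k+4) i * auxg k i (6*k+6))]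
    exact Finset.sum_congr rfl fun i _ => by
      rw [show 6*k+7-3 = 6*k+4 by omega, aux_mulVec]; rfl
  refine ⟨?_, ?_, ?_⟩
  · rw [(aux_main _ _ hs _ _ ⟨0, by omega⟩).1, hu, show 6*k+7-3 = 6*k+4 by omega, aux_mulVec]
    simp [auxg, auxp, F12]
  · rw [(aux_main _ _ hs _ _ _).2, show 6*k+7-3 = 6*k+4 by omega, aux_mulVec]
    simp [auxg, auxp, F12]
  · rw [(aux_main _ _ hs _ _ _).2, show 6*k+7-3 = 6*k+4 by omega, aux_mulVec]
    simp [auxg, auxp, F12]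
end

section
/- Let X = [[0, 1], [−1, 0]] and Y = [[0, 1], [−1, 2]], both elements of SL₂(ℤ). Then the subgroup of SL₂(ℤ) generated by X and Y has finite index in SL₂(ℤ). (In fact ±XY and ±YX generate the principal congruence subgroup Γ(2), and X² = −I, so ⟨X, Y⟩ contains Γ(2).) This group is the preimage under the spin homomorphism of the image of the 3-dimensional hyperbolic hypergeometric monodromy group with α = (1/4, 1/2, 3/4), β = (0, 0, 0), which is therefore arithmetic. -/
open Matrix

/-- The matrix `X = [[0, 1], [-1, 0]]` as an element of `SL₂(ℤ)`. -/
def X17 : Matrix.SpecialLinearGroup (Fin 2) ℤ :=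
  ⟨!![0, 1; -1, 0], by norm_num [Matrix.det_fin_two_of]⟩

/-- The matrix `Y = [[0, 1], [-1, 2]]` as an element of `SL₂(ℤ)`. -/
def Y17 : Matrix.SpecialLinearGroup (Fin 2) ℤ :=
  ⟨!![0, 1; -1, 2], by norm_num [Matrix.det_fin_two_of]⟩


theorem aux17 {G : Type*} [Group G] (s t : G) (hG : Subgroup.closure {s, t} = ⊤)
    (H : Subgroup G) (hs : s ∈ H) (htt : t * t ∈ H) (hst : s * s * t = t * (s * s))
    (h3 : t * s * t * s * t = s) : H.FiniteIndex := by
  have hc : (s * t)⁻¹ * t * (s * t) ∈ H := by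
    have : (s * t)⁻¹ * t * (s * t) = (t * t)⁻¹ * s⁻¹ := by
      have : t * s * t = s * t⁻¹ * s⁻¹ := by
        rw [eq_mul_inv_iff_mul_eq, eq_mul_inv_iff_mul_eq]; exact h3
      calc (s * t)⁻¹ * t * (s * t) = (s * t)⁻¹ * (t * s * t) := by group
        _ = _ := by rw [this]; group
    rw [this]
    exact H.mul_mem (H.inv_mem htt) (H.inv_mem hs)
  have hd : t⁻¹ * (s * (s * t)) ∈ H := by
    have : t⁻¹ * (s * (s * t)) = s * s := by
      rw [← mul_assoc s s t, hst]; group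
    rw [this]; exact H.mul_mem hs hs
  have key : ∀ g : G, g ∈ H ∨ t⁻¹ * g ∈ H ∨ (s * t)⁻¹ * g ∈ H := by
    intro g
    have hg : g ∈ Subgroup.closure {s, t} := by rw [hG]; trivial
    induction hg using Subgroup.closure_induction_left with
    | one => exact Or.inl H.one_mem
    | mul_left x hx y _ ih =>
      rcases hx with rfl | rfl
      · rcases ih with h | h | h
        · exact Or.inl (H.mul_mem hs h)
        · right; right; convert h using 1; group
        · right; left; convert H.mul_mem hd h using 1; group
      · rcases ih with h | h | h
        · right; left; convert h using 1; group
        · left; convert H.mul_mem htt h using 1; group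
        · right; right; convert H.mul_mem hc h using 1; group
    | inv_mul_cancel x hx y _ ih =>
      rcases hx with rfl | rfl
      · rcases ih with h | h | h
        · exact Or.inl (H.mul_mem (H.inv_mem hs) h)
        · right; right; convert H.mul_mem (H.inv_mem hd) h using 1; group
        · right; left; convert h using 1; group
      · rcases ih with h | h | h
        · right; left; convert H.mul_mem (H.inv_mem htt) h using 1; group
        · left; convert h using 1
        · right; right; convert H.mul_mem (H.inv_mem hc) h using 1; group
  have : Finite (G ⧸ H) := by
    refine Set.finite_univ_iff.mp (Set.Finite.subset
      (s := {((1 : G) : G ⧸ H), (t : G ⧸ H), ((s * t : G) : G ⧸ H)}) (Set.toFinite _) ?_)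
    intro q _
    induction q using QuotientGroup.induction_on with
    | H g =>
      rcases key g with h | h | h
      · left; exact (QuotientGroup.eq.mpr (by simpa using h)).symm
      · right; left; exact (QuotientGroup.eq.mpr h).symm
      · right; right; exact (QuotientGroup.eq.mpr h).symm
  exact Subgroup.finiteIndex_of_finite_quotient

theorem stmt17 : (Subgroup.closure {X17, Y17}).FiniteIndex := by
  have hX : X17 ∈ Subgroup.closure {X17, Y17} := Subgroup.subset_closure (by simp)
  have hY : Y17 ∈ Subgroup.closure {X17, Y17} := Subgroup.subset_closure (by simp)
  refine aux17 ModularGroup.S ModularGroup.T SpecialLinearGroup.SL2Z_generators _ ?_ ?_ ?_ ?_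
  · have : ModularGroup.S = X17 * X17 * X17 := by decide
    rw [this]
    exact mul_mem (mul_mem hX hX) hX
  · have : ModularGroup.T * ModularGroup.T = (X17 * Y17)⁻¹ * (X17 * X17) := by
      rw [eq_inv_mul_iff_mul_eq]; decide
    rw [this]
    exact mul_mem (inv_mem (mul_mem hX hY)) (mul_mem hX hX)
  · decide
  · decide
end

section
/- Let X = [[1, 0], [4, 1]] and Y = [[1, 1], [0, 1]], both elements of SL₂(ℤ). Then the subgroup of SL₂(ℤ) generated by X, Y and −I contains the principal congruence subgroup Γ(4), and hence has finite index in SL₂(ℤ). This group is the preimage under the spin homomorphism of the image of the 3-dimensional hyperbolic hypergeometric monodromy group with α = (1/2, 1/2, 1/2), β = (0, 0, 0), which is therefore arithmetic. -/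
open Matrix

/-- The matrix `X = [[1, 0], [4, 1]]` as an element of `SL₂(ℤ)`. -/
def X19 : Matrix.SpecialLinearGroup (Fin 2) ℤ :=
  ⟨!![1, 0; 4, 1], by norm_num [Matrix.det_fin_two_of]⟩

/-- The matrix `Y = [[1, 1], [0, 1]]` as an element of `SL₂(ℤ)`. -/
def Y19 : Matrix.SpecialLinearGroup (Fin 2) ℤ :=
  ⟨!![1, 1; 0, 1], by norm_num [Matrix.det_fin_two_of]⟩

/-- The matrix `-I` as an element of `SL₂(ℤ)`. -/
def negI : Matrix.SpecialLinearGroup (Fin 2) ℤ :=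
  ⟨!![-1, 0; 0, -1], by norm_num [Matrix.det_fin_two_of]⟩

theorem gamma0_aux (n : ℕ) : ∀ g : Matrix.SpecialLinearGroup (Fin 2) ℤ,
    (g 0 0).natAbs + (g 1 0).natAbs = n → (4 : ℤ) ∣ g 1 0 →
    g ∈ Subgroup.closure {X19, Y19, negI} := by
  induction n using Nat.strong_induction_on with
  | _ n ih =>
  intro g hn h4
  have hX : X19 ∈ Subgroup.closure {X19, Y19, negI} := Subgroup.subset_closure (by simp)
  have hY : Y19 ∈ Subgroup.closure {X19, Y19, negI} := Subgroup.subset_closure (by simp)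
  have hI : negI ∈ Subgroup.closure {X19, Y19, negI} := Subgroup.subset_closure (by simp)
  have hdet : g 0 0 * g 1 1 - g 0 1 * g 1 0 = 1 := by
    have := g.det_coe
    rwa [Matrix.det_fin_two] at this
  have step : ∀ u ∈ Subgroup.closure {X19, Y19, negI},
      ((u * g) 0 0).natAbs + ((u * g) 1 0).natAbs < n → (4 : ℤ) ∣ (u * g) 1 0 →
      g ∈ Subgroup.closure {X19, Y19, negI} := by
    intro u hu hlt hd
    exact (Subgroup.mul_mem_cancel_left _ hu).1 (ih _ hlt (u * g) rfl hd)
  have hXc : (X19 : Matrix (Fin 2) (Fin 2) ℤ) = !![1, 0; 4, 1] := rfl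
  have hYc : (Y19 : Matrix (Fin 2) (Fin 2) ℤ) = !![1, 1; 0, 1] := rfl
  have hXic : ((X19⁻¹ : Matrix.SpecialLinearGroup (Fin 2) ℤ) : Matrix (Fin 2) (Fin 2) ℤ) = !![1, 0; -4, 1] := by
    rw [Matrix.SpecialLinearGroup.coe_inv, hXc, Matrix.adjugate_fin_two_of]; simp
  have hYic : ((Y19⁻¹ : Matrix.SpecialLinearGroup (Fin 2) ℤ) : Matrix (Fin 2) (Fin 2) ℤ) = !![1, -1; 0, 1] := by
    rw [Matrix.SpecialLinearGroup.coe_inv, hYc, Matrix.adjugate_fin_two_of]; simp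
  have hX0 : (X19 * g) 0 0 = g 0 0 := by
    rw [Matrix.SpecialLinearGroup.coe_mul, hXc, Matrix.mul_apply, Fin.sum_univ_two]; simp
  have hX1 : (X19 * g) 1 0 = 4 * g 0 0 + g 1 0 := by
    rw [Matrix.SpecialLinearGroup.coe_mul, hXc, Matrix.mul_apply, Fin.sum_univ_two]; simp
  have hXi0 : (X19⁻¹ * g) 0 0 = g 0 0 := by
    rw [Matrix.SpecialLinearGroup.coe_mul, hXic, Matrix.mul_apply, Fin.sum_univ_two]; simp
  have hXi1 : (X19⁻¹ * g) 1 0 = -4 * g 0 0 + g 1 0 := by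
    rw [Matrix.SpecialLinearGroup.coe_mul, hXic, Matrix.mul_apply, Fin.sum_univ_two]; simp
  have hY0 : (Y19 * g) 0 0 = g 0 0 + g 1 0 := by
    rw [Matrix.SpecialLinearGroup.coe_mul, hYc, Matrix.mul_apply, Fin.sum_univ_two]; simp
  have hY1 : (Y19 * g) 1 0 = g 1 0 := by
    rw [Matrix.SpecialLinearGroup.coe_mul, hYc, Matrix.mul_apply, Fin.sum_univ_two]; simp
  have hYi0 : (Y19⁻¹ * g) 0 0 = g 0 0 - g 1 0 := by
    rw [Matrix.SpecialLinearGroup.coe_mul, hYic, Matrix.mul_apply, Fin.sum_univ_two]; simp; ring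
  have hYi1 : (Y19⁻¹ * g) 1 0 = g 1 0 := by
    rw [Matrix.SpecialLinearGroup.coe_mul, hYic, Matrix.mul_apply, Fin.sum_univ_two]; simp
  have hXi := Subgroup.inv_mem _ hX
  have hYi := Subgroup.inv_mem _ hY
  have hodd : g 0 0 % 2 = 1 := by
    obtain ⟨k, hk⟩ := h4
    rcases Int.emod_two_eq_zero_or_one (g 0 0) with h | h
    · exfalso
      obtain ⟨m, hm⟩ := Int.dvd_of_emod_eq_zero h
      rw [hm, hk] at hdet
      have : 2 * (m * g 1 1 - 2 * (g 0 1 * k)) = 1 := by linarith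
      omega
    · exact h
  by_cases hc : g 1 0 = 0
  · have hYT : Y19 = ModularGroup.T := rfl
    rw [hc, mul_zero, sub_zero] at hdet
    rcases Int.mul_eq_one_iff_eq_one_or_neg_one.1 hdet with ⟨ha, hd⟩ | ⟨ha, hd⟩
    · have : g = Y19 ^ (g 0 1) := by
        ext i j
        rw [hYT, ModularGroup.coe_T_zpow]
        fin_cases i <;> fin_cases j <;> simp [ha, hd, hc]
      rw [this]
      exact Subgroup.zpow_mem _ hY _
    · have : g = negI * Y19 ^ (-(g 0 1)) := by
        ext i j
        rw [hYT, Matrix.SpecialLinearGroup.coe_mul, ModularGroup.coe_T_zpow]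
        fin_cases i <;> fin_cases j <;> simp [ha, hd, hc, negI]
      rw [this]
      exact Subgroup.mul_mem _ hI (Subgroup.zpow_mem _ hY _)
  · by_cases hlt : 2 * (g 0 0).natAbs < (g 1 0).natAbs
    · by_cases hs : (0 < g 0 0 ∧ 0 < g 1 0) ∨ (g 0 0 < 0 ∧ g 1 0 < 0)
      · refine step _ hXi ?_ ?_
        · rw [hXi0, hXi1]; omega
        · rw [hXi1]; omega
      · refine step _ hX ?_ ?_
        · rw [hX0, hX1]; omega
        · rw [hX1]; omega
    · by_cases hs : (0 < g 0 0 ∧ 0 < g 1 0) ∨ (g 0 0 < 0 ∧ g 1 0 < 0)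
      · refine step _ hYi ?_ ?_
        · rw [hYi0, hYi1]; omega
        · rw [hYi1]; omega
      · refine step _ hY ?_ ?_
        · rw [hY0, hY1]; omega
        · rw [hY1]; omega

theorem stmt19 :
    CongruenceSubgroup.Gamma 4 ≤ Subgroup.closure {X19, Y19, negI} ∧
    (Subgroup.closure {X19, Y19, negI}).FiniteIndex := by
  have h : CongruenceSubgroup.Gamma 4 ≤ Subgroup.closure {X19, Y19, negI} := by
    intro g hg
    refine gamma0_aux _ g rfl ?_
    rw [CongruenceSubgroup.Gamma_mem] at hg
    exact_mod_cast (ZMod.intCast_zmod_eq_zero_iff_dvd (g 1 0) 4).1 hg.2.2.1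
  exact ⟨h, Subgroup.finiteIndex_of_le h⟩
end
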